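/- arXiv:1010.0867 — 7 statements merged into one kernel-verified Lean document; each statement's English description precedes it below -/
import Mathlib

section
/- (Inversion formula for the Wigner transform on the hyperbolic disc.) Let a : 𝔻 × S¹ × ℝ → ℂ be smooth and compactly supported, and define the Wigner transform 𝒲a(r, b, r', b') = ∫_𝔻 a(z,b,r) P(z,b)^{1/2+ir} P(z,b')^{1/2+ir'} Vol(dz). Then for every z ∈ 𝔻, b ∈ S¹ and r ∈ ℝ, a(z, b, r) = P(z,b)^{−(1/2+ir)} · (1/2) · ∫_{S¹} ∫_ℝ P(z,b')^{1/2−ir'} 𝒲a(r, b, r', b') (2π)^{−1} r'·tanh(πr') dr' db'. -/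
open Complex MeasureTheory Real

noncomputable section

/-- Poisson kernel on 𝔻 × S¹. -/
def Pk (z b : ℂ) : ℝ := (1 - ‖z‖ ^ 2) / ‖z - b‖ ^ 2

/-- Normalized arclength (probability) measure on the unit circle S¹ ⊆ ℂ. -/
def circleMeasure : Measure ℂ :=
  (ENNReal.ofReal (2 * Real.pi))⁻¹ •
    (volume.restrict (Set.Ioc (0 : ℝ) (2 * Real.pi))).map
      (fun θ : ℝ => Complex.exp ((θ : ℂ) * Complex.I))

/-- Hyperbolic area measure on the unit disc 𝔻. -/
def hypVol : Measure ℂ :=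
  (volume.restrict (Metric.ball (0 : ℂ) 1)).withDensity
    (fun z => ENNReal.ofReal (4 / (1 - ‖z‖ ^ 2) ^ 2))

theorem hasFDerivAt_intervalIntegral_param {E F : Type} [NormedAddCommGroup E] [NormedSpace ℝ E]
    [ProperSpace E] [NormedAddCommGroup F] [NormedSpace ℝ F] [CompleteSpace F]
    {f : E × ℝ → F} (hf : ContDiff ℝ 1 f) (a b : ℝ) (x : E) :
    HasFDerivAt (fun x => ∫ t in a..b, f (x, t))
      (∫ t in a..b, (fderiv ℝ f (x, t)).comp (ContinuousLinearMap.inl ℝ E ℝ)) x := by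
  have hc : Continuous fun p : E × ℝ =>
      (fderiv ℝ f p).comp (ContinuousLinearMap.inl ℝ E ℝ) :=
    (hf.continuous_fderiv one_ne_zero).clm_comp continuous_const
  obtain ⟨C, hC⟩ := ((isCompact_closedBall x 1).prod (isCompact_uIcc (a := a) (b := b))
    ).exists_bound_of_continuousOn hc.continuousOn
  refine intervalIntegral.hasFDerivAt_integral_of_dominated_of_fderiv_le
    (𝕜 := ℝ) (F := fun x t => f (x, t)) (bound := fun _ => C)
    (F' := fun x t => (fderiv ℝ f (x, t)).comp (ContinuousLinearMap.inl ℝ E ℝ))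
    (Metric.ball_mem_nhds x one_pos) ?_ ?_ ?_ ?_ ?_ ?_
  · exact .of_forall fun y =>
      (hf.continuous.comp (Continuous.prodMk_right y)).aestronglyMeasurable
  · exact (hf.continuous.comp (Continuous.prodMk_right x)).intervalIntegrable _ _
  · exact (hc.comp (Continuous.prodMk_right x)).aestronglyMeasurable
  · refine .of_forall fun t ht y hy => hC (y, t) ⟨Metric.ball_subset_closedBall hy, ?_⟩
    exact Set.uIoc_subset_uIcc ht
  · simp
  · refine .of_forall fun t _ y _ => ?_
    exact ((hf.differentiable one_ne_zero (y, t)).hasFDerivAt).comp y (hasFDerivAt_prodMk_left y t)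

theorem contDiff_intervalIntegral_param {E : Type} [NormedAddCommGroup E] [NormedSpace ℝ E]
    [ProperSpace E] (n : ℕ) {F : Type} [NormedAddCommGroup F] [NormedSpace ℝ F] [CompleteSpace F]
    {f : E × ℝ → F} (hf : ContDiff ℝ n f) (a b : ℝ) :
    ContDiff ℝ n fun x => ∫ t in a..b, f (x, t) := by
  induction n generalizing F with
  | zero =>
    exact contDiff_zero.2 (intervalIntegral.continuous_parametric_intervalIntegral_of_continuous'
      (f := fun x t => f (x, t)) hf.continuous a b)
  | succ n ih =>
    have h1 : ContDiff ℝ 1 f := hf.of_le (by exact_mod_cast Nat.le_add_left 1 n)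
    have hd := hasFDerivAt_intervalIntegral_param h1 a b
    rw [show ((n + 1 : ℕ) : WithTop ℕ∞) = (n : WithTop ℕ∞) + 1 by norm_cast] at hf ⊢
    rw [contDiff_succ_iff_fderiv]
    refine ⟨fun x => (hd x).differentiableAt, by simp, ?_⟩
    rw [show fderiv ℝ (fun x => ∫ t in a..b, f (x, t)) = _ from funext fun x => (hd x).fderiv]
    exact ih (f := fun p => (fderiv ℝ f p).comp (ContinuousLinearMap.inl ℝ E ℝ))
      ((hf.fderiv_right le_rfl).clm_comp contDiff_const)

theorem contDiff_infty_intervalIntegral_param {E F : Type} [NormedAddCommGroup E] [NormedSpace ℝ E]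
    [ProperSpace E] [NormedAddCommGroup F] [NormedSpace ℝ F] [CompleteSpace F]
    {f : E × ℝ → F} (hf : ContDiff ℝ (⊤ : ℕ∞) f) (a b : ℝ) :
    ContDiff ℝ (⊤ : ℕ∞) fun x => ∫ t in a..b, f (x, t) :=
  contDiff_infty.2 fun n => contDiff_intervalIntegral_param n (contDiff_infty.1 hf n) a b

theorem ofReal_mul_I_mem_integerComplement {x : ℝ} (hx : x ≠ 0) :
    (x : ℂ) * I ∈ Complex.integerComplement := by
  rintro ⟨n, hn⟩
  have := congrArg Complex.im hn
  simp at this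
  exact hx this.symm

theorem pi_mul_tan_eq_tsum {x : ℂ} (hx : x ∈ Complex.integerComplement)
    (hx2 : 2 * x ∈ Complex.integerComplement) :
    π * Complex.tan (π * x) = ∑' k : ℕ, 2 * x / ((k + 1 / 2) ^ 2 - x ^ 2) := by
  have h1 := cot_series_rep' hx
  have h2 := cot_series_rep' hx2
  have s1 := summable_cotTerm hx
  have s2 := summable_cotTerm hx2
  have hodd : ∀ k : ℕ, cotTerm (2 * x) (2 * k + 1) = 2⁻¹ * cotTerm x k := by
    intro k
    simp only [cotTerm]
    push_cast
    rw [show 2 * x - (2 * (k : ℂ) + 1 + 1) = 2 * (x - (k + 1)) by ring,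
      show 2 * x + (2 * (k : ℂ) + 1 + 1) = 2 * (x + (k + 1)) by ring]
    simp only [one_div, mul_inv]
    ring
  have heven : ∀ k : ℕ,
      2 * x / ((k + 1 / 2) ^ 2 - x ^ 2) = -2 * cotTerm (2 * x) (2 * k) := by
    intro k
    have e1 : 2 * x - ((2 * k : ℕ) + 1) ≠ 0 := fun h =>
      hx2 ⟨2 * k + 1, by push_cast at h ⊢; linear_combination -h⟩
    have e2 : 2 * x + ((2 * k : ℕ) + 1) ≠ 0 := fun h =>
      hx2 ⟨-(2 * k + 1), by push_cast at h ⊢; linear_combination -h⟩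
    have e3 : ((k : ℂ) + 1 / 2) ^ 2 - x ^ 2 =
        -(2 * x - ((2 * k : ℕ) + 1)) * (2 * x + ((2 * k : ℕ) + 1)) / 4 := by
      push_cast; ring
    rw [e3]
    simp only [cotTerm]
    field_simp
    ring
  have hsplit := tsum_even_add_odd (f := cotTerm (2 * x))
    (s2.comp_injective (mul_right_injective₀ two_ne_zero))
    (s2.comp_injective (i := fun k : ℕ => 2 * k + 1) fun a b h => by simpa using h)
  simp only [hodd, tsum_mul_left] at hsplit
  simp only [heven, tsum_mul_left]
  simp only [cotTerm] at hsplit ⊢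
  rw [← h1, ← h2] at hsplit
  have hs : Complex.sin (π * x) ≠ 0 := by
    intro h
    rw [Complex.sin_eq_zero_iff] at h
    obtain ⟨k, hk⟩ := h
    refine hx ⟨k, ?_⟩
    have : (π : ℂ) ≠ 0 := by exact_mod_cast Real.pi_ne_zero
    apply mul_left_cancel₀ this
    linear_combination -hk
  have hc : Complex.cos (π * x) ≠ 0 := by
    intro h
    rw [Complex.cos_eq_zero_iff] at h
    obtain ⟨k, hk⟩ := h
    refine hx2 ⟨2 * k + 1, ?_⟩
    have : (π : ℂ) ≠ 0 := by exact_mod_cast Real.pi_ne_zero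
    apply mul_left_cancel₀ this
    push_cast
    linear_combination (-2) * hk
  have hcot : Complex.tan (π * x) = Complex.cot (π * x) - 2 * Complex.cot (π * (2 * x)) := by
    rw [show (π : ℂ) * (2 * x) = 2 * (π * x) by ring, Complex.tan_eq_sin_div_cos,
      Complex.cot_eq_cos_div_sin, Complex.cot_eq_cos_div_sin, Complex.sin_two_mul,
      Complex.cos_two_mul']
    field_simp
    ring
  rw [hcot]
  linear_combination (2 : ℂ) * hsplit

theorem pi_mul_tanh_eq_tsum (r : ℝ) :
    ((π * Real.tanh (π * r) : ℝ) : ℂ) = ∑' k : ℕ, 2 * (r : ℂ) / ((k + 1 / 2) ^ 2 + r ^ 2) := by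
  rcases eq_or_ne r 0 with rfl | hr
  · simp
  have h := pi_mul_tan_eq_tsum (ofReal_mul_I_mem_integerComplement hr) (by
    have := ofReal_mul_I_mem_integerComplement (x := 2 * r) (by simpa using hr)
    push_cast at this
    rwa [mul_assoc] at this)
  rw [← mul_assoc, Complex.tan_mul_I] at h
  apply mul_right_cancel₀ I_ne_zero
  push_cast
  rw [mul_assoc, h, ← tsum_mul_right]
  refine tsum_congr fun k => ?_
  rw [mul_pow, I_sq]
  ring

theorem integral_sin_mul_exp_neg_mul_Ioi (r : ℝ) {s : ℝ} (hs : 0 < s) :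
    ∫ u in Set.Ioi (0 : ℝ), Complex.sin (r * u) * Complex.exp (-s * u) =
      r / ((s : ℂ) ^ 2 + r ^ 2) := by
  have hre1 : (-s + r * I : ℂ).re < 0 := by simpa using hs
  have hre2 : (-s - r * I : ℂ).re < 0 := by simpa using hs
  have key : ∀ u : ℝ, Complex.sin (r * u) * Complex.exp (-s * u) =
      (Complex.exp ((-s - r * I) * u) - Complex.exp ((-s + r * I) * u)) * (I / 2) := by
    intro u
    rw [Complex.sin, show (-s - r * I : ℂ) * u = -(r * u) * I + (-s * u) by ring,
      show (-s + r * I : ℂ) * u = (r * u) * I + (-s * u) by ring, Complex.exp_add, Complex.exp_add]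
    ring
  simp_rw [key]
  rw [integral_mul_const, integral_sub (integrableOn_exp_mul_complex_Ioi hre2 0)
    (integrableOn_exp_mul_complex_Ioi hre1 0), integral_exp_mul_complex_Ioi hre1,
    integral_exp_mul_complex_Ioi hre2]
  have n1 : (-s + r * I : ℂ) ≠ 0 := fun h => by rw [h] at hre1; simp at hre1
  have n2 : (-s - r * I : ℂ) ≠ 0 := fun h => by rw [h] at hre2; simp at hre2
  have n3 : (s : ℂ) ^ 2 + r ^ 2 = (-s + r * I) * (-s - r * I) := by
    ring_nf; rw [I_sq]; ring
  rw [n3]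
  simp only [ofReal_zero, mul_zero, Complex.exp_zero]
  field_simp
  ring_nf
  rw [I_sq]; ring

theorem hasSum_exp_inv_sinh {u : ℝ} (hu : 0 < u) :
    HasSum (fun k : ℕ => 2 * Complex.exp (-((k + 1 / 2 : ℝ) : ℂ) * u))
      ((Real.sinh (u / 2) : ℂ)⁻¹) := by
  have hlt : Real.exp (-u) < 1 := by simpa using hu
  have h := (hasSum_geometric_of_lt_one (Real.exp_pos (-u)).le hlt).mul_left
    (2 * Real.exp (-(u / 2)))
  have h' : HasSum (fun k : ℕ => 2 * Real.exp (-(k + 1 / 2) * u)) (Real.sinh (u / 2))⁻¹ := by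
    convert! h using 1
    · ext k
      rw [← Real.exp_nat_mul, mul_assoc, ← Real.exp_add]
      ring_nf
    · rw [Real.sinh_eq, inv_eq_iff_eq_inv, mul_inv, inv_inv, mul_inv, ← Real.exp_neg, neg_neg,
        mul_sub, mul_one, mul_assoc, ← Real.exp_add]
      ring_nf
  have := Complex.ofRealCLM.hasSum h'
  simpa using this

theorem integral_sin_div_sinh (r : ℝ) :
    ∫ u in Set.Ioi (0 : ℝ), Complex.sin (r * u) * (Real.sinh (u / 2) : ℂ)⁻¹ =
      ((π * Real.tanh (π * r) : ℝ) : ℂ) := by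
  have hpos : ∀ k : ℕ, (0 : ℝ) < k + 1 / 2 := fun k => by positivity
  have hinteg : ∀ k : ℕ, IntegrableOn (fun u : ℝ => Real.exp (-((k + 1 / 2 : ℝ) / 2) * u))
    (Set.Ioi 0) := fun k => integrableOn_exp_mul_Ioi (by linarith [hpos k]) 0
  have hbd : ∀ (k : ℕ), ∀ u ∈ Set.Ioi (0 : ℝ),
      ‖Complex.sin (r * u) * (2 * Complex.exp (-((k + 1 / 2 : ℝ) : ℂ) * u))‖ ≤
      4 * |r| / (k + 1 / 2) * Real.exp (-((k + 1 / 2 : ℝ) / 2) * u) := by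
    intro k u hu
    have hu : (0 : ℝ) < u := hu
    have e1 : ‖Complex.sin (r * u)‖ ≤ |r| * u := by
      rw [← ofReal_mul, ← Complex.ofReal_sin, Complex.norm_real, Real.norm_eq_abs]
      exact Real.abs_sin_le_abs.trans (by rw [abs_mul, abs_of_pos hu])
    have e2 : ‖Complex.exp (-((k + 1 / 2 : ℝ) : ℂ) * u)‖ = Real.exp (-(k + 1 / 2) * u) := by
      rw [Complex.norm_exp]; simp
    rw [norm_mul, norm_mul, e2, Complex.norm_ofNat]
    have e3 : u ≤ 2 / (k + 1 / 2) * Real.exp ((k + 1 / 2 : ℝ) / 2 * u) := by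
      have := Real.add_one_le_exp ((k + 1 / 2 : ℝ) / 2 * u)
      rw [div_mul_eq_mul_div, le_div_iff₀ (hpos k)]
      linarith
    calc ‖Complex.sin (r * u)‖ * (2 * Real.exp (-(k + 1 / 2) * u))
        ≤ (|r| * (2 / (k + 1 / 2) * Real.exp ((k + 1 / 2 : ℝ) / 2 * u))) *
          (2 * Real.exp (-(k + 1 / 2) * u)) := by
          gcongr; exact e1.trans (by gcongr)
      _ = 4 * |r| / (k + 1 / 2) * (Real.exp ((k + 1 / 2 : ℝ) / 2 * u) *
          Real.exp (-(k + 1 / 2) * u)) := by ring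
      _ = _ := by rw [← Real.exp_add]; ring_nf
  have hI : ∀ k : ℕ, IntegrableOn (fun u : ℝ =>
      Complex.sin (r * u) * (2 * Complex.exp (-((k + 1 / 2 : ℝ) : ℂ) * u))) (Set.Ioi 0) := by
    intro k
    refine Integrable.mono' ((hinteg k).const_mul (4 * |r| / (k + 1 / 2))) ?_ ?_
    · exact Continuous.aestronglyMeasurable (by fun_prop)
    · exact (ae_restrict_iff' measurableSet_Ioi).2 (.of_forall (hbd k))
  have hS : Summable fun k : ℕ => ∫ u in Set.Ioi (0 : ℝ),
      ‖Complex.sin (r * u) * (2 * Complex.exp (-((k + 1 / 2 : ℝ) : ℂ) * u))‖ := by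
    have hsum : Summable fun k : ℕ => 8 * |r| * (1 / |(k : ℝ) + 1 / 2| ^ (2 : ℝ)) :=
      ((Real.summable_one_div_nat_add_rpow (1 / 2) 2).2 (by norm_num)).mul_left _
    refine Summable.of_nonneg_of_le (fun k => integral_nonneg fun _ => norm_nonneg _) (fun k => ?_)
      hsum
    refine (setIntegral_mono_on (hI k).norm ((hinteg k).const_mul _) measurableSet_Ioi
      (hbd k)).trans (le_of_eq ?_)
    rw [integral_const_mul, integral_exp_mul_Ioi (by linarith [hpos k]), abs_of_pos (hpos k)]
    have := (hpos k).ne'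
    norm_num
    field_simp
    ring
  have hmain := integral_tsum_of_summable_integral_norm hI hS
  rw [pi_mul_tanh_eq_tsum]
  trans ∫ u in Set.Ioi (0 : ℝ), ∑' k : ℕ,
      Complex.sin (r * u) * (2 * Complex.exp (-((k + 1 / 2 : ℝ) : ℂ) * u))
  · refine setIntegral_congr_fun measurableSet_Ioi fun u hu => ?_
    exact ((hasSum_exp_inv_sinh hu).mul_left _).tsum_eq.symm
  rw [← hmain]
  refine tsum_congr fun k => ?_
  have := integral_sin_mul_exp_neg_mul_Ioi r (hpos k)
  simp_rw [mul_left_comm _ (2 : ℂ)]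
  rw [integral_const_mul, this]
  push_cast
  ring

theorem mul_inv_sinh_half_le {u : ℝ} (hu : 0 < u) :
    u * (Real.sinh (u / 2))⁻¹ ≤ 4 * Real.exp (-(1 / 4) * u) := by
  have h1 : u / 4 ≤ Real.sinh (u / 4) := Real.self_le_sinh_iff.2 (by linarith)
  have h2 : Real.exp (u / 4) / 2 ≤ Real.cosh (u / 4) := by
    rw [Real.cosh_eq]; linarith [Real.exp_pos (-(u / 4))]
  have h3 : Real.sinh (u / 2) = 2 * Real.sinh (u / 4) * Real.cosh (u / 4) := by
    rw [← Real.sinh_two_mul]; ring_nf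
  have h4 : u / 4 * Real.exp (u / 4) ≤ Real.sinh (u / 2) := by
    rw [h3]
    nlinarith [mul_le_mul h1 h2 (by positivity) (by linarith)]
  rw [← div_eq_mul_inv, div_le_iff₀ (Real.sinh_pos_iff.2 (by linarith))]
  calc u = 4 * Real.exp (-(1 / 4) * u) * (u / 4 * Real.exp (u / 4)) := by
        rw [show 4 * Real.exp (-(1 / 4) * u) * (u / 4 * Real.exp (u / 4)) =
          u * (Real.exp (-(1 / 4) * u) * Real.exp (u / 4)) by ring, ← Real.exp_add]
        ring_nf; simp
    _ ≤ _ := by gcongr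

theorem integral_schwartz_mul_tanh (S : SchwartzMap ℝ ℂ) :
    ∫ ξ : ℝ, S ξ * ((Real.tanh (π * (2 * π * ξ)) : ℝ) : ℂ) =
      (π : ℂ)⁻¹ * ∫ u in Set.Ioi (0 : ℝ), (∫ ξ : ℝ, S ξ * Complex.sin ((2 * π * ξ : ℝ) * u)) *
        ((Real.sinh (u / 2) : ℝ) : ℂ)⁻¹ := by
  have h1 : ∀ ξ : ℝ, S ξ * ((Real.tanh (π * (2 * π * ξ)) : ℝ) : ℂ) =
      (π : ℂ)⁻¹ * ∫ u in Set.Ioi (0 : ℝ), S ξ * Complex.sin ((2 * π * ξ : ℝ) * u) *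
        ((Real.sinh (u / 2) : ℝ) : ℂ)⁻¹ := by
    intro ξ
    simp_rw [mul_assoc (S ξ)]
    rw [integral_const_mul, integral_sin_div_sinh]
    have : (π : ℂ) ≠ 0 := by exact_mod_cast Real.pi_ne_zero
    push_cast
    field_simp
  simp_rw [h1]
  rw [integral_const_mul, integral_integral_swap]
  · simp_rw [integral_mul_const]
  have hb : Integrable (fun p : ℝ × ℝ => (2 * π * (‖p.1‖ ^ 1 * ‖S p.1‖)) *
      (4 * Real.exp (-(1 / 4) * p.2))) (volume.prod (volume.restrict (Set.Ioi 0))) :=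
    ((S.integrable_pow_mul volume 1).const_mul _).mul_prod
      ((integrableOn_exp_mul_Ioi (by norm_num) 0).const_mul _)
  refine hb.mono' ?_ ?_
  · refine Measurable.aestronglyMeasurable ?_
    have := S.continuous.measurable
    unfold Function.uncurry
    fun_prop
  · have : ∀ᵐ p : ℝ × ℝ ∂(volume.prod (volume.restrict (Set.Ioi (0 : ℝ)))), p.2 ∈ Set.Ioi (0 : ℝ) :=
      Measure.quasiMeasurePreserving_snd.ae (ae_restrict_mem measurableSet_Ioi)
    filter_upwards [this] with p hp
    have hp : 0 < p.2 := hp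
    have hs : 0 < Real.sinh (p.2 / 2) := Real.sinh_pos_iff.2 (by linarith)
    have e1 : ‖Complex.sin ((2 * π * p.1 : ℝ) * p.2)‖ ≤ 2 * π * |p.1| * p.2 := by
      rw [← ofReal_mul, ← Complex.ofReal_sin, Complex.norm_real, Real.norm_eq_abs]
      refine Real.abs_sin_le_abs.trans (le_of_eq ?_)
      rw [abs_mul, abs_mul, abs_of_pos hp, abs_of_pos Real.two_pi_pos]
    simp only [Function.uncurry, norm_mul, norm_inv, Complex.norm_real, Real.norm_eq_abs, pow_one,
      abs_of_pos hs]
    calc ‖S p.1‖ * ‖Complex.sin ((2 * π * p.1 : ℝ) * p.2)‖ * (Real.sinh (p.2 / 2))⁻¹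
        ≤ ‖S p.1‖ * (2 * π * |p.1| * p.2) * (Real.sinh (p.2 / 2))⁻¹ := by gcongr
      _ = (2 * π * (|p.1| * ‖S p.1‖)) * (p.2 * (Real.sinh (p.2 / 2))⁻¹) := by ring
      _ ≤ _ := mul_le_mul_of_nonneg_left (mul_inv_sinh_half_le hp) (by positivity)

open scoped FourierTransform in
theorem integral_fourier_mul_tanh {G : ℝ → ℂ} (hG : ContDiff ℝ (⊤ : ℕ∞) G)
    (hGc : HasCompactSupport G) :
    ∫ r : ℝ, (∫ u : ℝ, Complex.exp (I * r * u) * G u) * ((r * Real.tanh (π * r) : ℝ) : ℂ) =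
      ∫ u in Set.Ioi (0 : ℝ), (deriv G (-u) - deriv G u) * ((Real.sinh (u / 2) : ℝ) : ℂ)⁻¹ := by
  have hD : ContDiff ℝ (⊤ : ℕ∞) (deriv G) := (contDiff_infty_iff_deriv.1 hG).2
  set T : SchwartzMap ℝ ℂ := hGc.deriv.toSchwartzMap hD with hT
  have hTD : (T : ℝ → ℂ) = deriv G := rfl
  have hfour : 𝓕 (deriv G) = fun x : ℝ => (2 * π * I * x) • 𝓕 G x :=
    Real.fourier_deriv (hG.continuous.integrable_of_hasCompactSupport hGc)
      (hG.differentiable (by simp)) (hD.continuous.integrable_of_hasCompactSupport hGc.deriv)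
  set S : SchwartzMap ℝ ℂ := 𝓕 T with hS
  have hSc : (S : ℝ → ℂ) = 𝓕 (deriv G) := by rw [hS, SchwartzMap.fourier_coe, hTD]
  have hinv : ∀ v : ℝ, ∫ ξ : ℝ, Complex.exp ((2 * π * (ξ * v) : ℝ) * I) * S ξ = deriv G v := by
    intro v
    have h : 𝓕⁻ (𝓕 (deriv G)) = deriv G :=
      hD.continuous.fourierInv_fourier_eq
        (hD.continuous.integrable_of_hasCompactSupport hGc.deriv) (hSc ▸ S.integrable)
    have h2 := congrFun h v
    rw [Real.fourierInv_eq', ← hSc] at h2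
    rw [← h2]
    refine integral_congr_ae (.of_forall fun ξ => ?_)
    simp [mul_comm v]
  have hsin : ∀ u : ℝ, ∫ ξ : ℝ, S ξ * Complex.sin ((2 * π * ξ : ℝ) * u) =
      (deriv G (-u) - deriv G u) * (I / 2) := by
    intro u
    have hinteg : ∀ v : ℝ, Integrable fun ξ : ℝ => Complex.exp ((2 * π * (ξ * v) : ℝ) * I) * S ξ := by
      intro v
      refine S.integrable.norm.mono' ?_ (.of_forall fun ξ => ?_)
      · exact Continuous.aestronglyMeasurable (by have := S.continuous; fun_prop)
      · rw [norm_mul, Complex.norm_exp_ofReal_mul_I, one_mul]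
    rw [← hinv, ← hinv, ← integral_sub (hinteg _) (hinteg _), ← integral_mul_const]
    refine integral_congr_ae (.of_forall fun ξ => ?_)
    simp only [Complex.sin]
    rw [show ((2 * π * (ξ * -u) : ℝ) : ℂ) * I = -((2 * π * ξ : ℝ) * u) * I by push_cast; ring,
      show ((2 * π * (ξ * u) : ℝ) : ℂ) * I = ((2 * π * ξ : ℝ) * u) * I by push_cast; ring]
    ring
  have h2 := integral_schwartz_mul_tanh S
  simp_rw [hsin, mul_right_comm _ (I / 2)] at h2
  rw [integral_mul_const] at h2
  have h3 := Measure.integral_comp_mul_left (fun r : ℝ =>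
    (∫ u : ℝ, Complex.exp (I * r * u) * G u) * ((r * Real.tanh (π * r) : ℝ) : ℂ)) (-(2 * π))
  have h4 : ∀ ξ : ℝ, (∫ u : ℝ, Complex.exp (I * (-(2 * π) * ξ : ℝ) * u) * G u) *
      (((-(2 * π) * ξ) * Real.tanh (π * (-(2 * π) * ξ)) : ℝ) : ℂ) =
      -I * (S ξ * ((Real.tanh (π * (2 * π * ξ)) : ℝ) : ℂ)) := by
    intro ξ
    have : ∫ u : ℝ, Complex.exp (I * (-(2 * π) * ξ : ℝ) * u) * G u = 𝓕 G ξ := by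
      rw [Real.fourier_real_eq_integral_exp_smul]
      refine integral_congr_ae (.of_forall fun u => ?_)
      simp only [smul_eq_mul]
      congr 2
      push_cast
      ring
    rw [this, hSc, hfour, show π * (-(2 * π) * ξ) = -(π * (2 * π * ξ)) by ring, Real.tanh_neg]
    simp only [smul_eq_mul]
    push_cast
    linear_combination (2 * π * ξ * 𝓕 G ξ * Complex.tanh (π * (2 * π * ξ))) * I_sq
  simp_rw [h4] at h3
  rw [integral_const_mul, h2, Complex.real_smul, abs_inv, abs_neg, abs_of_pos Real.two_pi_pos] at h3
  have hpi : (π : ℂ) ≠ 0 := by exact_mod_cast Real.pi_ne_zero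
  generalize ∫ r : ℝ, (∫ u : ℝ, Complex.exp (I * r * u) * G u) *
    ((r * Real.tanh (π * r) : ℝ) : ℂ) = X at h3 ⊢
  generalize ∫ u in Set.Ioi (0 : ℝ), (deriv G (-u) - deriv G u) *
    ((Real.sinh (u / 2) : ℝ) : ℂ)⁻¹ = Y at h3 ⊢
  push_cast at h3
  field_simp at h3
  rw [I_sq] at h3
  linear_combination -h3

theorem det_eq_re_mul_im_sub (L : ℂ →L[ℝ] ℂ) :
    L.det = (L 1).re * (L I).im - (L 1).im * (L I).re := by
  rw [ContinuousLinearMap.det, ← LinearMap.det_toMatrix basisOneI, Matrix.det_fin_two]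
  simp only [LinearMap.toMatrix_apply, coe_basisOneI, coe_basisOneI_repr,
    ContinuousLinearMap.coe_coe]
  simp
  ring

theorem integral_hypVol (F : ℂ → ℂ) :
    ∫ w, F w ∂hypVol = ∫ w in Metric.ball (0 : ℂ) 1, (4 / (1 - ‖w‖ ^ 2) ^ 2) • F w := by
  rw [hypVol, integral_withDensity_eq_integral_toReal_smul (by fun_prop) (by simp)]
  refine integral_congr_ae (.of_forall fun w => ?_)
  simp only
  rw [ENNReal.toReal_ofReal (by positivity)]

/-- The numerator of `horo`. -/
def horoNum (p : ℂ) : ℂ := p.im + 2 * I * (Real.sinh (p.re / 2) : ℝ)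

/-- The denominator of `horo`. -/
def horoDen (p : ℂ) : ℂ := p.im + 2 * I * (Real.cosh (p.re / 2) : ℝ)

/-- Horocyclic coordinates on the disc: `p.re` labels the horocycles tangent at `1`, and `p.im` is
a suitably normalized coordinate along each of them. -/
def horo (p : ℂ) : ℂ := horoNum p / horoDen p

theorem horoDen_ne_zero (p : ℂ) : horoDen p ≠ 0 := by
  intro h
  have := congrArg Complex.im h
  simp [horoDen, -ofReal_cosh] at this
  exact (Real.cosh_pos _).ne' this

theorem normSq_horoNum (p : ℂ) :
    normSq (horoNum p) = p.im ^ 2 + (2 * Real.sinh (p.re / 2)) ^ 2 := by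
  rw [horoNum, normSq_apply]
  simp [-ofReal_sinh]
  ring

theorem normSq_horoDen (p : ℂ) :
    normSq (horoDen p) = p.im ^ 2 + (2 * Real.sinh (p.re / 2)) ^ 2 + 4 := by
  rw [horoDen, normSq_apply]
  simp [-ofReal_cosh]
  nlinarith [Real.cosh_sq (p.re / 2)]

theorem norm_horo_sq (p : ℂ) :
    ‖horo p‖ ^ 2 = (p.im ^ 2 + (2 * Real.sinh (p.re / 2)) ^ 2) /
      (p.im ^ 2 + (2 * Real.sinh (p.re / 2)) ^ 2 + 4) := by
  rw [← normSq_eq_norm_sq, horo, map_div₀, normSq_horoNum, normSq_horoDen]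

theorem one_sub_norm_horo_sq (p : ℂ) : 1 - ‖horo p‖ ^ 2 = 4 / normSq (horoDen p) := by
  have : p.im ^ 2 + (2 * Real.sinh (p.re / 2)) ^ 2 + 4 ≠ 0 := by positivity
  rw [norm_horo_sq, normSq_horoDen]
  field_simp
  ring

theorem one_sub_horo (p : ℂ) : 1 - horo p = 2 * I * Real.exp (-(p.re / 2)) / horoDen p := by
  have := horoDen_ne_zero p
  rw [horo, one_sub_div this, horoDen, horoNum, ← Real.cosh_sub_sinh]
  push_cast
  ring_nf

theorem norm_horo_lt_one (p : ℂ) : ‖horo p‖ < 1 := by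
  have h : 0 < 1 - ‖horo p‖ ^ 2 := by
    rw [one_sub_norm_horo_sq]
    have := normSq_pos.2 (horoDen_ne_zero p)
    positivity
  nlinarith [norm_nonneg (horo p)]

theorem Pk_horo_one (p : ℂ) : Pk (horo p) 1 = Real.exp p.re := by
  have h := normSq_pos.2 (horoDen_ne_zero p)
  rw [Pk, norm_sub_rev, one_sub_norm_horo_sq, one_sub_horo, ← normSq_eq_norm_sq, map_div₀]
  simp only [map_mul, normSq_ofReal, normSq_I]
  rw [show p.re = p.re / 2 + p.re / 2 by ring, Real.exp_add, Real.exp_neg]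
  have := Real.exp_pos ((p.re / 2 + p.re / 2) / 2)
  have h2 : normSq 2 = 4 := by rw [normSq_eq_norm_sq]; norm_num
  rw [h2]
  field_simp
  ring_nf

theorem horo_injective : Function.Injective horo := by
  intro p q h
  have h1 : p.re = q.re := by
    have := Pk_horo_one p
    rw [h, Pk_horo_one] at this
    exact (Real.exp_injective this).symm
  have h2 := one_sub_horo p
  rw [h, one_sub_horo, h1] at h2
  have hne : (2 * I * Real.exp (-(q.re / 2)) : ℂ) ≠ 0 := by
    simp
  rw [div_eq_mul_inv, div_eq_mul_inv] at h2
  replace h2 := inv_injective (mul_left_cancel₀ hne h2)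
  have h3 := congrArg Complex.re h2
  simp [horoDen, -ofReal_cosh] at h3
  exact Complex.ext h1 h3.symm

theorem range_horo : Set.range horo = Metric.ball (0 : ℂ) 1 := by
  ext w
  rw [mem_ball_zero_iff]
  refine ⟨fun ⟨p, hp⟩ => hp ▸ norm_horo_lt_one p, fun hw => ?_⟩
  have hne : 1 - w ≠ 0 := fun h => by
    rw [sub_eq_zero] at h; rw [← h] at hw; simp at hw
  have hw2 : 0 < 1 - ‖w‖ ^ 2 := by nlinarith [norm_nonneg w]
  have hN : 0 < normSq (1 - w) := normSq_pos.2 hne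
  set u := Real.log ((1 - ‖w‖ ^ 2) / normSq (1 - w)) with hu
  have hexp : Real.exp u = (1 - ‖w‖ ^ 2) / normSq (1 - w) := Real.exp_log (by positivity)
  set D : ℂ := 2 * I * Real.exp (-(u / 2)) / (1 - w) with hD
  refine ⟨⟨u, D.re⟩, ?_⟩
  have hDim : D.im = 2 * Real.cosh (u / 2) := by
    have e1 : D.im = 2 * Real.exp (-(u / 2)) * ((1 - w).re / normSq (1 - w)) := by
      rw [hD, show (2 * I * Real.exp (-(u / 2)) / (1 - w) : ℂ) =
        ((2 * Real.exp (-(u / 2)) : ℝ) : ℂ) * (I * (1 - w)⁻¹) by push_cast; field_simp,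
        Complex.im_ofReal_mul]
      simp [Complex.inv_re]
    have e2 : 2 * (1 - w).re / normSq (1 - w) = Real.exp u + 1 := by
      rw [hexp, div_add_one hN.ne', ← normSq_eq_norm_sq]
      congr 1
      simp [normSq_apply]
      ring
    have e3 : Real.exp u = Real.exp (u / 2) * Real.exp (u / 2) := by
      rw [← Real.exp_add]; ring_nf
    rw [e1, Real.cosh_eq]
    calc 2 * Real.exp (-(u / 2)) * ((1 - w).re / normSq (1 - w))
        = Real.exp (-(u / 2)) * (2 * (1 - w).re / normSq (1 - w)) := by ring
      _ = _ := by
        rw [e2, e3, Real.exp_neg]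
        field_simp
  have hden : horoDen ⟨u, D.re⟩ = D := by
    apply Complex.ext <;> simp [horoDen, hDim, -Complex.ofReal_cosh]
  have := one_sub_horo ⟨u, D.re⟩
  rw [hden] at this
  have h2 : (2 * I * Real.exp (-(u / 2)) : ℂ) / D = 1 - w := by
    rw [hD]
    have : (2 * I * Real.exp (-(u / 2)) : ℂ) ≠ 0 := by simp
    field_simp
  simp only at this
  rw [h2] at this
  linear_combination -this

theorem contDiff_horo : ContDiff ℝ (⊤ : ℕ∞) horo := by
  have hre : ContDiff ℝ (⊤ : ℕ∞) (fun p : ℂ => p.re) := reCLM.contDiff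
  have him : ContDiff ℝ (⊤ : ℕ∞) (fun p : ℂ => (p.im : ℂ)) :=
    ofRealCLM.contDiff.comp imCLM.contDiff
  have h : horo = fun p => horoNum p * (horoDen p)⁻¹ := funext fun p => div_eq_mul_inv _ _
  rw [h]
  refine ContDiff.mul ?_ (ContDiff.inv ?_ horoDen_ne_zero)
  · exact him.add (contDiff_const.mul
      (ofRealCLM.contDiff.comp (Real.contDiff_sinh.comp (hre.div_const 2))))
  · exact him.add (contDiff_const.mul
      (ofRealCLM.contDiff.comp (Real.contDiff_cosh.comp (hre.div_const 2))))

theorem det_fderiv_horo (p : ℂ) :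
    |(fderiv ℝ horo p).det| = 4 * Real.exp (-(p.re / 2)) / normSq (horoDen p) ^ 2 := by
  have hd : HasFDerivAt horo (fderiv ℝ horo p) p :=
    (contDiff_horo.differentiable (by simp) p).hasFDerivAt
  have hne := horoDen_ne_zero p
  have hsh : HasDerivAt (fun t : ℝ => ((Real.sinh ((p + t).re / 2) : ℝ) : ℂ))
      (Real.cosh (p.re / 2) / 2 : ℝ) 0 := by
    refine HasDerivAt.ofReal_comp ?_
    have h1 : HasDerivAt (fun t : ℝ => (p + t).re / 2) (1 / 2) 0 := by
      simpa using ((hasDerivAt_id (0 : ℝ)).const_add p.re).div_const 2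
    convert! h1.sinh using 1
    simp; ring
  have hch : HasDerivAt (fun t : ℝ => ((Real.cosh ((p + t).re / 2) : ℝ) : ℂ))
      (Real.sinh (p.re / 2) / 2 : ℝ) 0 := by
    refine HasDerivAt.ofReal_comp ?_
    have h1 : HasDerivAt (fun t : ℝ => (p + t).re / 2) (1 / 2) 0 := by
      simpa using ((hasDerivAt_id (0 : ℝ)).const_add p.re).div_const 2
    convert! h1.cosh using 1
    simp; ring
  have h1 : fderiv ℝ horo p 1 =
      (I * Real.cosh (p.re / 2) * horoDen p - horoNum p * (I * Real.sinh (p.re / 2))) /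
        horoDen p ^ 2 := by
    have hline : HasDerivAt (fun t : ℝ => p + t) 1 0 :=
      (Complex.ofRealCLM.hasDerivAt).const_add p
    have hN : HasDerivAt (fun t : ℝ => horoNum (p + t)) (I * Real.cosh (p.re / 2)) 0 := by
      unfold horoNum
      convert! (hsh.const_mul (2 * I)).const_add (p.im : ℂ) using 1
      · ext t; simp
      · push_cast; ring
    have hD : HasDerivAt (fun t : ℝ => horoDen (p + t)) (I * Real.sinh (p.re / 2)) 0 := by
      unfold horoDen
      convert! (hch.const_mul (2 * I)).const_add (p.im : ℂ) using 1
      · ext t; simp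
      · push_cast; ring
    have hq := hN.div hD (by simpa using hne)
    have hc := HasFDerivAt.comp_hasDerivAt (x := (0 : ℝ)) (f := fun t : ℝ => p + t)
      (l := horo) (l' := fderiv ℝ horo p) (by simpa using hd) hline
    have := hc.unique hq
    simpa using this
  have h2 : fderiv ℝ horo p I = (horoDen p - horoNum p) / horoDen p ^ 2 := by
    have hline : HasDerivAt (fun t : ℝ => p + t * I) I 0 := by
      simpa using ((Complex.ofRealCLM.hasDerivAt (x := 0)).mul_const I).const_add p
    have hid : HasDerivAt (fun t : ℝ => ((p + t * I).im : ℂ)) 1 0 := by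
      simpa using (Complex.ofRealCLM.hasDerivAt (x := 0)).const_add (p.im : ℂ)
    have hN : HasDerivAt (fun t : ℝ => horoNum (p + t * I)) 1 0 := by
      unfold horoNum
      convert! hid.add_const (2 * I * (Real.sinh (p.re / 2) : ℝ)) using 1
      ext t; simp
    have hD : HasDerivAt (fun t : ℝ => horoDen (p + t * I)) 1 0 := by
      unfold horoDen
      convert! hid.add_const (2 * I * (Real.cosh (p.re / 2) : ℝ)) using 1
      ext t; simp
    have hq := hN.div hD (by simpa using hne)
    have hc := HasFDerivAt.comp_hasDerivAt (x := (0 : ℝ)) (f := fun t : ℝ => p + t * I)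
      (l := horo) (l' := fderiv ℝ horo p) (by simpa using hd) hline
    have := hc.unique hq
    simpa using this
  have key : (fderiv ℝ horo p).det =
      (starRingEnd ℂ (fderiv ℝ horo p 1) * fderiv ℝ horo p I).im := by
    rw [det_eq_re_mul_im_sub]
    simp
    ring
  have hE : Real.exp (-(p.re / 2)) = Real.cosh (p.re / 2) - Real.sinh (p.re / 2) :=
    (Real.cosh_sub_sinh _).symm
  have hcs := Real.cosh_sq (p.re / 2)
  have hprod : starRingEnd ℂ (fderiv ℝ horo p 1) * fderiv ℝ horo p I =
      ((normSq (horoDen p) ^ 2)⁻¹ : ℝ) *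
      (starRingEnd ℂ (I * Real.cosh (p.re / 2) * horoDen p - horoNum p * (I * Real.sinh (p.re / 2)))
        * (horoDen p - horoNum p)) := by
    rw [h1, h2, map_div₀, map_pow]
    push_cast
    rw [normSq_eq_conj_mul_self]
    field_simp
  have hnum : (starRingEnd ℂ (I * Real.cosh (p.re / 2) * horoDen p -
      horoNum p * (I * Real.sinh (p.re / 2))) * (horoDen p - horoNum p)).im =
      -(4 * Real.exp (-(p.re / 2))) := by
    simp [horoDen, horoNum, -ofReal_cosh, -ofReal_sinh]
    linear_combination (-4 * (Real.cosh (p.re / 2) - Real.sinh (p.re / 2))) * hcs + 4 * hE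
  rw [key, hprod, Complex.im_ofReal_mul, hnum, abs_mul, abs_neg,
    abs_of_nonneg (by positivity), abs_of_nonneg (by positivity)]
  ring

theorem integral_hypVol_eq_horo (F : ℂ → ℂ) :
    ∫ w, F w ∂hypVol = ∫ p : ℂ, (Real.exp (-(p.re / 2)) : ℂ) * F (horo p) := by
  rw [integral_hypVol, ← range_horo, ← Set.image_univ,
    integral_image_eq_integral_abs_det_fderiv_smul volume MeasurableSet.univ
      (fun p _ => ((contDiff_horo.differentiable (by simp) p).hasFDerivAt).hasFDerivWithinAt)
      horo_injective.injOn, Measure.restrict_univ]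
  refine integral_congr_ae (.of_forall fun p => ?_)
  have := normSq_pos.2 (horoDen_ne_zero p)
  simp only [det_fderiv_horo, one_sub_norm_horo_sq, Complex.real_smul, ← mul_assoc]
  congr 1
  norm_cast
  field_simp

/-- The Möbius transformation of the disc taking `0` to `z`. -/
def mob (z w : ℂ) : ℂ := (w + z) / (1 + starRingEnd ℂ z * w)

theorem mob_den_ne_zero {z w : ℂ} (hz : ‖z‖ < 1) (hw : ‖w‖ ≤ 1) : 1 + starRingEnd ℂ z * w ≠ 0 := by
  intro h
  have h1 : ‖starRingEnd ℂ z * w‖ = 1 := by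
    rw [show starRingEnd ℂ z * w = -1 by linear_combination h]; simp
  rw [norm_mul, RCLike.norm_conj] at h1
  nlinarith [norm_nonneg z, norm_nonneg w]

theorem one_sub_norm_mob_sq {z w : ℂ} (h : 1 + starRingEnd ℂ z * w ≠ 0) :
    1 - ‖mob z w‖ ^ 2 =
      (1 - ‖z‖ ^ 2) * (1 - ‖w‖ ^ 2) / normSq (1 + starRingEnd ℂ z * w) := by
  have hN := normSq_pos.2 h
  simp only [← normSq_eq_norm_sq, mob, map_div₀]
  rw [eq_div_iff hN.ne', sub_mul, div_mul_cancel₀ _ hN.ne']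
  simp [normSq_apply]
  ring

theorem norm_mob_lt_one {z w : ℂ} (hz : ‖z‖ < 1) (hw : ‖w‖ < 1) : ‖mob z w‖ < 1 := by
  have hd := mob_den_ne_zero hz hw.le
  have hN := normSq_pos.2 hd
  have h : 0 < 1 - ‖mob z w‖ ^ 2 := by
    rw [one_sub_norm_mob_sq hd]
    have h1 : 0 < 1 - ‖z‖ ^ 2 := by nlinarith [norm_nonneg z]
    have h2 : 0 < 1 - ‖w‖ ^ 2 := by nlinarith [norm_nonneg w]
    positivity
  nlinarith [norm_nonneg (mob z w)]

theorem norm_mob_eq_one {z w : ℂ} (hz : ‖z‖ < 1) (hw : ‖w‖ = 1) : ‖mob z w‖ = 1 := by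
  have h : 1 - ‖mob z w‖ ^ 2 = 0 := by
    rw [one_sub_norm_mob_sq (mob_den_ne_zero hz hw.le), hw]; simp
  nlinarith [norm_nonneg (mob z w)]

theorem one_sub_conj_mul_self_ne_zero {z : ℂ} (hz : ‖z‖ < 1) : 1 - starRingEnd ℂ z * z ≠ 0 := by
  rw [← normSq_eq_conj_mul_self, normSq_eq_norm_sq]
  norm_cast
  nlinarith [norm_nonneg z]

theorem mob_neg_mob {z w : ℂ} (hz : ‖z‖ < 1) (hw : ‖w‖ ≤ 1) : mob (-z) (mob z w) = w := by
  have hd := mob_den_ne_zero hz hw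
  have h0 := one_sub_conj_mul_self_ne_zero hz
  have h1 : 1 + starRingEnd ℂ (-z) * mob z w =
      (1 - starRingEnd ℂ z * z) / (1 + starRingEnd ℂ z * w) := by
    rw [mob, eq_div_iff hd, map_neg, add_mul, mul_assoc, div_mul_cancel₀ _ hd]
    ring
  have h2 : mob z w + -z = w * (1 - starRingEnd ℂ z * z) / (1 + starRingEnd ℂ z * w) := by
    rw [mob, eq_div_iff hd, add_mul, div_mul_cancel₀ _ hd]
    ring
  rw [mob, h1, h2, div_div_div_cancel_right₀ hd, mul_div_cancel_right₀ _ h0]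

theorem image_mob_ball {z : ℂ} (hz : ‖z‖ < 1) :
    mob z '' Metric.ball 0 1 = Metric.ball 0 1 := by
  ext w
  simp only [Set.mem_image, mem_ball_zero_iff]
  constructor
  · rintro ⟨v, hv, rfl⟩
    exact norm_mob_lt_one hz hv
  · intro hw
    have hz' : ‖-z‖ < 1 := by rwa [norm_neg]
    exact ⟨mob (-z) w, norm_mob_lt_one hz' hw, by simpa using mob_neg_mob hz' hw.le⟩

theorem hasDerivAt_mob {z w : ℂ} (h : 1 + starRingEnd ℂ z * w ≠ 0) :
    HasDerivAt (mob z) ((1 - starRingEnd ℂ z * z) / (1 + starRingEnd ℂ z * w) ^ 2) w := by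
  have h1 : HasDerivAt (fun w => w + z) 1 w := (hasDerivAt_id w).add_const z
  have h2 : HasDerivAt (fun w => 1 + starRingEnd ℂ z * w) (starRingEnd ℂ z) w := by
    simpa using ((hasDerivAt_id w).const_mul (starRingEnd ℂ z)).const_add 1
  convert! h1.div h2 h using 1
  ring

theorem det_restrictScalars_toSpanSingleton (c : ℂ) :
    ((ContinuousLinearMap.toSpanSingleton ℂ c : ℂ →L[ℂ] ℂ).restrictScalars ℝ).det = normSq c := by
  rw [det_eq_re_mul_im_sub, normSq_apply]
  simp

/-- The hyperbolic area is invariant under Möbius transformations. -/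
theorem integral_mob {z : ℂ} (hz : ‖z‖ < 1) (F : ℂ → ℂ) :
    ∫ w, F (mob z w) ∂hypVol = ∫ w, F w ∂hypVol := by
  have hz2 : 0 < 1 - ‖z‖ ^ 2 := by nlinarith [norm_nonneg z]
  rw [integral_hypVol F, ← image_mob_ball hz]
  have hd : ∀ w ∈ Metric.ball (0 : ℂ) 1, HasFDerivWithinAt (mob z)
      (((ContinuousLinearMap.toSpanSingleton ℂ
        ((1 - starRingEnd ℂ z * z) / (1 + starRingEnd ℂ z * w) ^ 2)) : ℂ →L[ℂ] ℂ).restrictScalars ℝ)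
      (Metric.ball 0 1) w := fun w hw =>
    (((hasDerivAt_mob (mob_den_ne_zero hz (mem_ball_zero_iff.1 hw).le)).hasFDerivAt).restrictScalars
      ℝ).hasFDerivWithinAt
  rw [integral_image_eq_integral_abs_det_fderiv_smul volume Metric.isOpen_ball.measurableSet hd
      (fun v hv w hw h => by
        rw [← mob_neg_mob hz (mem_ball_zero_iff.1 hv).le, h,
          mob_neg_mob hz (mem_ball_zero_iff.1 hw).le]), integral_hypVol]
  refine setIntegral_congr_fun Metric.isOpen_ball.measurableSet fun w hw => ?_
  have hw1 := mem_ball_zero_iff.1 hw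
  have hw2 : 0 < 1 - ‖w‖ ^ 2 := by nlinarith [norm_nonneg w]
  have hden := mob_den_ne_zero hz hw1.le
  have hN := normSq_pos.2 hden
  have hdet : ((ContinuousLinearMap.toSpanSingleton ℂ
        ((1 - starRingEnd ℂ z * z) / (1 + starRingEnd ℂ z * w) ^ 2) : ℂ →L[ℂ] ℂ).restrictScalars
          ℝ).det = ((1 - ‖z‖ ^ 2) / normSq (1 + starRingEnd ℂ z * w)) ^ 2 := by
    have h1 : (1 - starRingEnd ℂ z * z : ℂ) = ((1 - ‖z‖ ^ 2 : ℝ) : ℂ) := by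
      rw [← normSq_eq_conj_mul_self, normSq_eq_norm_sq]; push_cast; ring
    rw [h1, det_restrictScalars_toSpanSingleton, map_div₀, map_pow, normSq_ofReal, div_pow]
    ring
  simp only [hdet, smul_smul, one_sub_norm_mob_sq hden]
  rw [abs_of_nonneg (by positivity)]
  congr 1
  field_simp

theorem Pk_mob {z w b : ℂ} (hz : ‖z‖ < 1) (hw : ‖w‖ < 1) (hb : ‖b‖ = 1) :
    Pk (mob z w) (mob z b) = Pk w b * Pk z (mob z b) := by
  have hz2 : 0 < 1 - ‖z‖ ^ 2 := by nlinarith [norm_nonneg z]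
  have hdw := mob_den_ne_zero hz hw.le
  have hdb := mob_den_ne_zero hz hb.le
  have hNw := normSq_pos.2 hdw
  have hNb := normSq_pos.2 hdb
  have hwb : 0 < normSq (w - b) := normSq_pos.2 (sub_ne_zero.2 fun h => by rw [h] at hw; linarith)
  have h1 : (1 - starRingEnd ℂ z * z : ℂ) = ((1 - ‖z‖ ^ 2 : ℝ) : ℂ) := by
    rw [← normSq_eq_conj_mul_self, normSq_eq_norm_sq]; push_cast; ring
  have e1 : mob z w - mob z b = (w - b) * ((1 - ‖z‖ ^ 2 : ℝ) : ℂ) /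
      ((1 + starRingEnd ℂ z * w) * (1 + starRingEnd ℂ z * b)) := by
    rw [← h1, mob, mob, div_sub_div _ _ hdw hdb]
    ring
  have e2 : z - mob z b = -(b * ((1 - ‖z‖ ^ 2 : ℝ) : ℂ)) / (1 + starRingEnd ℂ z * b) := by
    rw [← h1, mob, sub_div' hdb]
    ring
  have hb1 : normSq b = 1 := by rw [normSq_eq_norm_sq, hb]; norm_num
  simp only [Pk, one_sub_norm_mob_sq hdw, e1, e2]
  simp only [← normSq_eq_norm_sq] at hz2 ⊢
  simp only [map_div₀, map_mul, normSq_neg, normSq_ofReal, hb1]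
  field_simp

theorem Pk_mul_left {c w b : ℂ} (hc : ‖c‖ = 1) : Pk (c * w) (c * b) = Pk w b := by
  simp [Pk, ← mul_sub, hc]

theorem integral_hypVol_mul_left {c : ℂ} (hc : ‖c‖ = 1) (F : ℂ → ℂ) :
    ∫ w, F (c * w) ∂hypVol = ∫ w, F w ∂hypVol := by
  rw [integral_hypVol, integral_hypVol]
  have hball : ∀ w : ℂ, w ∈ Metric.ball (0 : ℂ) 1 ↔ c * w ∈ Metric.ball (0 : ℂ) 1 := by
    simp [hc]
  let e : ℂ ≃ₗᵢ[ℝ] ℂ := rotation ⟨c, by simp [Submonoid.unitSphere, hc]⟩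
  have he : ∀ w, e w = c * w := fun w => rfl
  rw [← integral_indicator Metric.isOpen_ball.measurableSet,
    ← integral_indicator Metric.isOpen_ball.measurableSet]
  rw [← e.measurePreserving.integral_comp e.toHomeomorph.measurableEmbedding
    ((Metric.ball (0 : ℂ) 1).indicator fun w => (4 / (1 - ‖w‖ ^ 2) ^ 2) • F w)]
  refine integral_congr_ae (.of_forall fun w => ?_)
  by_cases hw : w ∈ Metric.ball (0 : ℂ) 1
  · rw [Set.indicator_of_mem hw]
    change _ = (Metric.ball (0 : ℂ) 1).indicator _ (c * w)
    rw [Set.indicator_of_mem ((hball w).1 hw), norm_mul, hc, one_mul]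
  · rw [Set.indicator_of_notMem hw]
    change _ = (Metric.ball (0 : ℂ) 1).indicator _ (c * w)
    rw [Set.indicator_of_notMem (mt (hball w).2 hw)]

theorem integral_circleMeasure (g : ℂ → ℂ) :
    ∫ b, g b ∂circleMeasure =
      ((2 * π)⁻¹ : ℝ) • ∫ θ in Set.Ioc (0 : ℝ) (2 * π), g (cexp (θ * I)) := by
  have hm : Measurable fun θ : ℝ => cexp (θ * I) := by fun_prop
  have hinj : Function.Injective fun θ : Set.Ioc (0 : ℝ) (2 * π) => cexp ((θ : ℝ) * I) := by
    intro x y h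
    obtain ⟨n, hn⟩ := Complex.exp_eq_exp_iff_exists_int.1 h
    have h1 : (x : ℝ) = y + n * (2 * π) := by
      have := congrArg Complex.im hn
      simpa using this
    have hx := x.2
    have hy := y.2
    have hπ := Real.pi_pos
    have h2 : (n : ℝ) < 1 := by
      by_contra! hc
      nlinarith [hx.2, hy.1]
    have h3 : (-1 : ℝ) < n := by
      by_contra! hc
      nlinarith [hx.1, hy.2]
    have h4 : n = 0 := by
      have : n < 1 := by exact_mod_cast h2
      have : -1 < n := by exact_mod_cast h3
      omega
    exact Subtype.ext (by simpa [h4] using h1)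
  have := (measurableSet_Ioc (a := (0 : ℝ)) (b := 2 * π)).standardBorel
  have hemb : MeasurableEmbedding fun θ : Set.Ioc (0 : ℝ) (2 * π) => cexp ((θ : ℝ) * I) :=
    (hm.comp measurable_subtype_coe).measurableEmbedding hinj
  rw [circleMeasure, integral_smul_measure, ENNReal.toReal_inv,
    ENNReal.toReal_ofReal (by positivity), ← map_comap_subtype_coe measurableSet_Ioc,
    Measure.map_map hm measurable_subtype_coe]
  congr 1
  rw [show (fun θ : ℝ => cexp (θ * I)) ∘ Subtype.val =
    fun θ : Set.Ioc (0 : ℝ) (2 * π) => cexp ((θ : ℝ) * I) from rfl, hemb.integral_map,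
    map_comap_subtype_coe measurableSet_Ioc]
  exact integral_subtype_comap measurableSet_Ioc fun θ : ℝ => g (cexp (θ * I))

theorem integral_circle_mul_left {c : ℂ} (hc : ‖c‖ = 1) (g : ℂ → ℂ) :
    ∫ θ in (0 : ℝ)..2 * π, g (c * cexp (θ * I)) = ∫ θ in (0 : ℝ)..2 * π, g (cexp (θ * I)) := by
  obtain ⟨α, rfl⟩ := (Complex.norm_eq_one_iff c).1 hc
  have hper : Function.Periodic (fun θ : ℝ => g (cexp (θ * I))) (2 * π) := fun θ => by
    simp only
    congr 1
    push_cast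
    rw [add_mul, Complex.exp_periodic]
  calc ∫ θ in (0 : ℝ)..2 * π, g (cexp (α * I) * cexp (θ * I))
      = ∫ θ in (0 : ℝ)..2 * π, (fun θ : ℝ => g (cexp (θ * I))) (θ + α) := by
        refine intervalIntegral.integral_congr fun θ _ => ?_
        simp only
        rw [← Complex.exp_add]
        push_cast
        ring_nf
    _ = ∫ θ in α..α + 2 * π, g (cexp (θ * I)) := by
        rw [intervalIntegral.integral_comp_add_right (fun θ : ℝ => g (cexp (θ * I)))]
        ring_nf
    _ = _ := by
        rw [hper.intervalIntegral_add_eq α 0, zero_add]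

/-- A rational parametrization of the unit circle minus `1`. -/
def circleParam (t : ℝ) : ℂ := (1 + t * I) / (t * I - 1)

theorem circleParam_den_ne_zero (t : ℝ) : (t * I - 1 : ℂ) ≠ 0 := fun h => by
  simpa using congrArg Complex.re h

theorem exp_pi_add_two_arctan (t : ℝ) :
    cexp (((π + 2 * Real.arctan t : ℝ) : ℂ) * I) = circleParam t := by
  have hs : (0 : ℝ) < √(1 + t ^ 2) := Real.sqrt_pos.2 (by positivity)
  have hs2 : ((√(1 + t ^ 2) : ℝ) : ℂ) ^ 2 = 1 + (t : ℂ) ^ 2 := by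
    norm_cast
    exact Real.sq_sqrt (by positivity)
  have hs0 : ((√(1 + t ^ 2) : ℝ) : ℂ) ≠ 0 := by exact_mod_cast hs.ne'
  have h1 : cexp (Real.arctan t * I) = (1 + t * I) / (√(1 + t ^ 2) : ℝ) := by
    rw [Complex.exp_mul_I, ← Complex.ofReal_cos, ← Complex.ofReal_sin, Real.cos_arctan,
      Real.sin_arctan]
    push_cast
    field_simp
  have h2 : cexp (((π + 2 * Real.arctan t : ℝ) : ℂ) * I) = -cexp (Real.arctan t * I) ^ 2 := by
    rw [← Complex.exp_nat_mul]
    push_cast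
    rw [add_mul, Complex.exp_add, Complex.exp_pi_mul_I]
    ring_nf
  have hne := circleParam_den_ne_zero t
  rw [h2, h1, circleParam, div_pow, hs2, eq_div_iff hne]
  have h3 : (1 + (t : ℂ) ^ 2) ≠ 0 := by rw [← hs2]; exact pow_ne_zero 2 hs0
  rw [neg_mul, div_mul_eq_mul_div, ← neg_div, div_eq_iff h3]
  linear_combination (-(1 + t * I) * (t : ℂ) ^ 2) * I_sq

theorem integral_circle_eq_integral_circleParam (J : ℂ → ℂ) :
    ∫ θ in Set.Ioc (0 : ℝ) (2 * π), J (cexp (θ * I)) =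
      ∫ t : ℝ, (2 / (1 + t ^ 2)) • J (circleParam t) := by
  have himg : (fun t : ℝ => π + 2 * Real.arctan t) '' Set.univ = Set.Ioo 0 (2 * π) := by
    ext θ
    simp only [Set.mem_image, Set.mem_univ, true_and, Set.mem_Ioo]
    constructor
    · rintro ⟨t, rfl⟩
      have h1 := Real.arctan_lt_pi_div_two t
      have h2 := Real.neg_pi_div_two_lt_arctan t
      constructor <;> linarith
    · rintro ⟨h1, h2⟩
      refine ⟨Real.tan ((θ - π) / 2), ?_⟩
      rw [Real.arctan_tan (by linarith) (by linarith)]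
      ring
  rw [integral_Ioc_eq_integral_Ioo, ← himg,
    integral_image_eq_integral_abs_deriv_smul (f' := fun t => 2 * (1 / (1 + t ^ 2)))
      MeasurableSet.univ
      (fun t _ => (((Real.hasDerivAt_arctan t).const_mul 2).const_add π).hasDerivWithinAt)
      (fun s _ t _ h => Real.arctan_injective (by simpa using h)), Measure.restrict_univ]
  refine integral_congr_ae (.of_forall fun t => ?_)
  simp only
  rw [exp_pi_add_two_arctan, abs_of_nonneg (by positivity), mul_one_div]

theorem mob_circleParam {ρ : ℝ} (h1 : ρ < 1) (t : ℝ) :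
    mob ρ (circleParam t) = circleParam ((1 + ρ) / (1 - ρ) * t) := by
  have hρ : (1 - ρ : ℂ) ≠ 0 := by exact_mod_cast (sub_pos.2 h1).ne'
  have hd := circleParam_den_ne_zero t
  have e1 : (((1 + ρ) / (1 - ρ) * t : ℝ) * I - 1 : ℂ) = ((1 + ρ) * t * I - (1 - ρ)) / (1 - ρ) := by
    push_cast
    field_simp
  have e2 : (1 + ((1 + ρ) / (1 - ρ) * t : ℝ) * I : ℂ) = ((1 + ρ) * t * I + (1 - ρ)) / (1 - ρ) := by
    push_cast
    field_simp
    ring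
  rw [circleParam.eq_1 ((1 + ρ) / (1 - ρ) * t), e1, e2, div_div_div_cancel_right₀ hρ, mob, circleParam,
    Complex.conj_ofReal, div_add' _ _ _ hd, ← mul_div_assoc, add_div' _ _ _ hd, div_div_div_cancel_right₀ hd]
  congr 1 <;> ring

theorem Pk_circleParam (ρ t : ℝ) :
    Pk ρ (circleParam t) =
      (1 - ρ ^ 2) * (1 + t ^ 2) / ((1 + ρ) ^ 2 + ((1 - ρ) * t) ^ 2) := by
  have hd := circleParam_den_ne_zero t
  have h2 : normSq (t * I - 1 : ℂ) = 1 + t ^ 2 := by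
    simp [normSq_apply]; ring
  have h3 : normSq (ρ * (t * I - 1) - (1 + t * I) : ℂ) = (1 + ρ) ^ 2 + ((1 - ρ) * t) ^ 2 := by
    simp [normSq_apply]; ring
  rw [Pk, circleParam, sub_div' hd, ← normSq_eq_norm_sq (_ / _), map_div₀, h2, h3]
  simp
  rw [div_div_eq_mul_div]

theorem integral_circle_mob_ofReal {ρ : ℝ} (h0 : 0 ≤ ρ) (h1 : ρ < 1) (J : ℂ → ℂ) :
    ∫ θ in Set.Ioc (0 : ℝ) (2 * π), J (mob ρ (cexp (θ * I))) =
      ∫ θ in Set.Ioc (0 : ℝ) (2 * π), Pk ρ (cexp (θ * I)) * J (cexp (θ * I)) := by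
  have hρ : 0 < 1 - ρ := sub_pos.2 h1
  have hl : 0 < (1 + ρ) / (1 - ρ) := by positivity
  rw [integral_circle_eq_integral_circleParam (fun b => J (mob ρ b)),
    integral_circle_eq_integral_circleParam (fun b => Pk ρ b * J b)]
  have := Measure.integral_comp_mul_left
    (fun s : ℝ => (2 / (1 + (s / ((1 + ρ) / (1 - ρ))) ^ 2)) • J (circleParam s)) ((1 + ρ) / (1 - ρ))
  rw [← integral_smul] at this
  convert this using 1
  · refine integral_congr_ae (.of_forall fun t => ?_)
    simp only [mob_circleParam h1, mul_div_cancel_left₀ _ hl.ne']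
  · refine integral_congr_ae (.of_forall fun t => ?_)
    simp only [Pk_circleParam, smul_smul, abs_of_pos (inv_pos.2 hl)]
    rw [← Complex.real_smul, smul_smul]
    congr 1
    have : (1 + ρ) ^ 2 + ((1 - ρ) * t) ^ 2 ≠ 0 := by positivity
    field_simp
    ring

/-- The pullback of the arclength measure under a Möbius transformation has density given by the
Poisson kernel. -/
theorem integral_circleMeasure_mob {z : ℂ} (hz : ‖z‖ < 1) (J : ℂ → ℂ) :
    ∫ b, J (mob z b) ∂circleMeasure = ∫ b, Pk z b * J b ∂circleMeasure := by
  obtain ⟨c, hc, hzc⟩ : ∃ c : ℂ, ‖c‖ = 1 ∧ z = c * (‖z‖ : ℝ) := by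
    refine ⟨cexp (z.arg * I), Complex.norm_exp_ofReal_mul_I _, ?_⟩
    rw [mul_comm, Complex.norm_mul_exp_arg_mul_I]
  have hπ : (0 : ℝ) ≤ 2 * π := by positivity
  have hcc : starRingEnd ℂ c * c = 1 := by
    rw [← normSq_eq_conj_mul_self, normSq_eq_norm_sq, hc]; simp
  have hmob : ∀ b, mob z (c * b) = c * mob (‖z‖ : ℝ) b := fun b => by
    rw [mob, mob, hzc, map_mul]
    simp only [norm_mul, hc, Complex.conj_ofReal, one_mul, Complex.norm_real, norm_norm]
    rw [← mul_div_assoc]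
    congr 1
    · ring
    · linear_combination (‖z‖ : ℂ) * b * hcc
  have hPk : ∀ b, Pk z (c * b) = Pk (‖z‖ : ℝ) b := fun b => by
    nth_rewrite 1 [hzc]
    exact Pk_mul_left hc
  rw [integral_circleMeasure, integral_circleMeasure]
  congr 1
  rw [← intervalIntegral.integral_of_le hπ, ← intervalIntegral.integral_of_le hπ,
    ← integral_circle_mul_left hc (fun b => J (mob z b)),
    ← integral_circle_mul_left hc (fun b => Pk z b * J b)]
  simp only [hmob, hPk]
  rw [intervalIntegral.integral_of_le hπ, intervalIntegral.integral_of_le hπ]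
  exact integral_circle_mob_ofReal (norm_nonneg z) hz fun b => J (c * b)

theorem integral_eq_two_mul_integral_Ioi {J : ℝ → ℂ} (hJ : Integrable J)
    (heven : ∀ x, J (-x) = J x) :
    ∫ x, J x = 2 * ∫ x in Set.Ioi 0, J x := by
  rw [← intervalIntegral.integral_Iic_add_Ioi (b := 0) hJ.integrableOn hJ.integrableOn]
  have h := integral_comp_neg_Ioi 0 J
  simp only [heven, neg_zero] at h
  rw [← h, two_mul]

theorem image_two_mul_sinh_half_Ioi :
    (fun u : ℝ => 2 * Real.sinh (u / 2)) '' Set.Ioi 0 = Set.Ioi 0 := by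
  ext v
  simp only [Set.mem_image, Set.mem_Ioi]
  constructor
  · rintro ⟨u, hu, rfl⟩
    have : 0 < Real.sinh (u / 2) := Real.sinh_pos_iff.2 (by linarith)
    linarith
  · intro hv
    refine ⟨2 * Real.arsinh (v / 2), ?_, ?_⟩
    · have := Real.arsinh_pos_iff.2 (half_pos hv)
      linarith
    · rw [mul_div_cancel_left₀ _ two_ne_zero, Real.sinh_arsinh]
      ring

theorem hasDerivAt_two_mul_sinh_half (u : ℝ) :
    HasDerivAt (fun u : ℝ => 2 * Real.sinh (u / 2)) (Real.cosh (u / 2)) u := by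
  convert! (((hasDerivAt_id u).div_const 2).sinh).const_mul 2 using 1
  simp
  ring

theorem integral_comp_two_mul_sinh_half (J : ℝ → ℂ) :
    ∫ u in Set.Ioi (0 : ℝ), Real.cosh (u / 2) • J (2 * Real.sinh (u / 2)) =
      ∫ v in Set.Ioi (0 : ℝ), J v := by
  nth_rewrite 2 [← image_two_mul_sinh_half_Ioi]
  rw [integral_image_eq_integral_abs_deriv_smul measurableSet_Ioi
    (fun u _ => (hasDerivAt_two_mul_sinh_half u).hasDerivWithinAt)
    (fun u _ v _ h => by
      have := Real.sinh_injective (mul_left_cancel₀ two_ne_zero h)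
      linarith)]
  simp only [abs_of_pos (Real.cosh_pos _)]

theorem contDiff_comp_ofReal {q : ℂ → ℂ} (hq : ContDiff ℝ (⊤ : ℕ∞) q) :
    ContDiff ℝ (⊤ : ℕ∞) fun y : ℝ => q y :=
  hq.comp ofRealCLM.contDiff

theorem hasCompactSupport_comp_ofReal {q : ℂ → ℂ} {M : ℝ} (hM : ∀ p, M ≤ ‖p‖ → q p = 0) :
    HasCompactSupport fun y : ℝ => q y := by
  refine HasCompactSupport.intro (isCompact_closedBall (0 : ℝ) M) fun y hy => hM _ ?_
  rw [mem_closedBall_zero_iff, not_le] at hy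
  simpa using hy.le

theorem deriv_comp_ofReal_eq_zero {q : ℂ → ℂ} {M : ℝ} (hM : ∀ p, M ≤ ‖p‖ → q p = 0)
    {y : ℝ} (hy : M < y) : deriv (fun y : ℝ => q y) y = 0 := by
  have : (fun y : ℝ => q y) =ᶠ[nhds y] fun _ => 0 := by
    filter_upwards [lt_mem_nhds hy] with x hx
    exact hM _ (by simpa using hx.le.trans (le_abs_self x))
  rw [this.deriv_eq, deriv_const]

theorem hasDerivAt_integral_vertical {q : ℂ → ℂ} (hq : ContDiff ℝ (⊤ : ℕ∞) q) (M v : ℝ) :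
    HasDerivAt (fun v : ℝ => ∫ s in (-M)..M, q ⟨v, s⟩)
      (∫ s in (-M)..M, fderiv ℝ q ⟨v, s⟩ 1) v := by
  have hF : ContDiff ℝ 1 fun x : ℝ × ℝ => q (x.1 + x.2 * I) :=
    (hq.of_le (by simp)).comp ((ofRealCLM.contDiff.comp contDiff_fst).add
      ((ofRealCLM.contDiff.comp contDiff_snd).mul contDiff_const))
  have h := (hasFDerivAt_intervalIntegral_param hF (-M) M v).hasDerivAt
  have hmk : ∀ v s : ℝ, (⟨v, s⟩ : ℂ) = v + s * I := fun v s => by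
    apply Complex.ext <;> simp
  simp only [hmk]
  convert! h using 1
  rw [ContinuousLinearMap.intervalIntegral_apply]
  · refine intervalIntegral.integral_congr fun s _ => ?_
    simp only [ContinuousLinearMap.comp_apply, ContinuousLinearMap.inl_apply]
    have hin : HasDerivAt (fun t : ℝ => (t + s * I : ℂ)) 1 v := by
      simpa using (ofRealCLM.hasDerivAt (x := v)).add_const (s * I : ℂ)
    have hq1 := ((hq.differentiable (by simp) (v + s * I : ℂ)).hasFDerivAt).comp_hasDerivAt v hin
    have hline : HasDerivAt (fun t : ℝ => (t, s)) ((1 : ℝ), (0 : ℝ)) v :=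
      (hasDerivAt_id v).prodMk (hasDerivAt_const v s)
    have hq2 := ((hF.differentiable (by simp) (v, s)).hasFDerivAt).comp_hasDerivAt v hline
    exact hq1.unique hq2
  · refine Continuous.intervalIntegrable ?_ _ _
    exact (((hF.continuous_fderiv one_ne_zero).comp (Continuous.prodMk_right v)).clm_comp
      continuous_const)

theorem fderiv_radial_apply_one {q : ℂ → ℂ} (hq : ContDiff ℝ (⊤ : ℕ∞) q)
    (hrad : ∀ p p', ‖p‖ = ‖p'‖ → q p = q p') {v : ℝ} (hv : v ≠ 0) (s : ℝ) :
    fderiv ℝ q ⟨v, s⟩ 1 =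
      v * (deriv (fun y : ℝ => q y) ‖(⟨v, s⟩ : ℂ)‖ / (‖(⟨v, s⟩ : ℂ)‖ : ℝ)) := by
  have hnorm : ∀ t : ℝ, ‖(⟨t, s⟩ : ℂ)‖ = √(t ^ 2 + s ^ 2) := fun t => by
    rw [Complex.norm_def, normSq_mk]
    ring_nf
  have hpos : 0 < v ^ 2 + s ^ 2 := by positivity
  have hmk : ∀ v s : ℝ, (⟨v, s⟩ : ℂ) = v + s * I := fun v s => by
    apply Complex.ext <;> simp
  have hin : HasDerivAt (fun t : ℝ => (⟨t, s⟩ : ℂ)) 1 v := by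
    simp only [hmk]
    simpa using (ofRealCLM.hasDerivAt (x := v)).add_const (s * I : ℂ)
  have h1 := ((hq.differentiable (by simp) (⟨v, s⟩ : ℂ)).hasFDerivAt).comp_hasDerivAt v hin
  have hsqrt : HasDerivAt (fun t : ℝ => √(t ^ 2 + s ^ 2)) (v / √(v ^ 2 + s ^ 2)) v := by
    have := ((hasDerivAt_pow 2 v).add_const (s ^ 2)).sqrt hpos.ne'
    convert! this using 1
    simp
    field_simp
  have h2 := HasDerivAt.scomp v
    ((((contDiff_comp_ofReal hq).differentiable (by simp)) √(v ^ 2 + s ^ 2)).hasDerivAt) hsqrt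
  have heq : (q ∘ fun t : ℝ => (⟨t, s⟩ : ℂ)) =
      (fun y : ℝ => q y) ∘ fun t : ℝ => √(t ^ 2 + s ^ 2) := by
    ext t
    refine hrad _ _ ?_
    rw [hnorm, Complex.norm_real, Real.norm_of_nonneg (Real.sqrt_nonneg _)]
  rw [heq] at h1
  rw [h1.unique h2, hnorm, Complex.real_smul]
  push_cast
  ring

/-- Abel transform inversion for a smooth compactly supported radial function on the plane. -/
theorem integral_deriv_abel_radial {q : ℂ → ℂ} (hq : ContDiff ℝ (⊤ : ℕ∞) q)
    (hrad : ∀ p p', ‖p‖ = ‖p'‖ → q p = q p') {M : ℝ} (hM0 : 0 ≤ M) (hM : ∀ p, M ≤ ‖p‖ → q p = 0)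
    {G : ℝ → ℂ} (hG : ∀ u, G u = ∫ s in (-M)..M, q ⟨2 * Real.sinh (u / 2), s⟩) :
    ∫ u in Set.Ioi (0 : ℝ), (deriv G (-u) - deriv G u) * ((Real.sinh (u / 2) : ℝ) : ℂ)⁻¹ =
      4 * π * q 0 := by
  set ψ : ℝ → ℂ := fun y => deriv (fun y : ℝ => q y) y / (y : ℝ) with hψ
  have hψ0 : ∀ p : ℂ, M < ‖p‖ → ψ ‖p‖ = 0 := fun p hp => by
    rw [hψ]; simp only; rw [deriv_comp_ofReal_eq_zero hM hp, zero_div]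
  set J : ℝ → ℂ := fun v => ∫ s : ℝ, ψ ‖(⟨v, s⟩ : ℂ)‖ with hJ
  have hint_radial : IntegrableOn (fun y : ℝ => y ^ (Module.finrank ℝ ℂ - 1) • ψ y)
      (Set.Ioi 0) := by
    have h : IntegrableOn (deriv fun y : ℝ => q y) (Set.Ioi 0) :=
      (((contDiff_comp_ofReal hq).continuous_deriv (by simp)).integrable_of_hasCompactSupport
        (hasCompactSupport_comp_ofReal hM).deriv).integrableOn
    refine h.congr_fun (fun y hy => ?_) measurableSet_Ioi
    have hy0 : (y : ℂ) ≠ 0 := by exact_mod_cast (Set.mem_Ioi.1 hy).ne'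
    simp only [Complex.finrank_real_complex, hψ, Complex.real_smul]
    simp
    field_simp
  have hplane_int : Integrable (fun p : ℂ => ψ ‖p‖) :=
    (integrable_fun_norm_addHaar volume).2 hint_radial
  have hplane : ∫ p : ℂ, ψ ‖p‖ = -(2 * π * q 0) := by
    rw [integral_fun_norm_addHaar volume ψ, Complex.finrank_real_complex]
    have h : ∫ y in Set.Ioi (0 : ℝ), y ^ (2 - 1) • ψ y = -q 0 := by
      have h0 := (hasCompactSupport_comp_ofReal hM).integral_Ioi_deriv_eq
        ((contDiff_comp_ofReal hq).of_le (by simp)) 0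
      rw [ofReal_zero] at h0
      rw [← h0]
      refine setIntegral_congr_fun measurableSet_Ioi fun y hy => ?_
      have hy0 : (y : ℂ) ≠ 0 := by exact_mod_cast (Set.mem_Ioi.1 hy).ne'
      simp only [hψ, Complex.real_smul]
      simp
      field_simp
    rw [h, Measure.real, Complex.volume_ball]
    simp
    ring
  have hprod_int : Integrable (fun x : ℝ × ℝ => ψ ‖(⟨x.1, x.2⟩ : ℂ)‖) (volume.prod volume) :=
    Complex.volume_preserving_equiv_real_prod.symm.integrable_comp_emb
      measurableEquivRealProd.symm.measurableEmbedding |>.2 hplane_int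
  have hJint : Integrable J := hprod_int.integral_prod_left
  have hJtot : ∫ v, J v = -(2 * π * q 0) := by
    rw [← hplane, hJ, integral_integral hprod_int]
    exact Complex.volume_preserving_equiv_real_prod.symm.integral_comp
      measurableEquivRealProd.symm.measurableEmbedding fun p => ψ ‖p‖
  have hJeven : ∀ v, J (-v) = J v := fun v => by
    change ∫ s : ℝ, ψ ‖(⟨-v, s⟩ : ℂ)‖ = ∫ s : ℝ, ψ ‖(⟨v, s⟩ : ℂ)‖
    simp only [Complex.norm_def, normSq_mk, neg_mul_neg]
  have hK := hasDerivAt_integral_vertical hq M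
  have hK' : ∀ v : ℝ, v ≠ 0 → ∫ s in (-M)..M, fderiv ℝ q ⟨v, s⟩ 1 = v * J v := fun v hv => by
    rw [intervalIntegral.integral_of_le (by linarith), ← integral_Icc_eq_integral_Ioc]
    change _ = v * ∫ s : ℝ, ψ ‖(⟨v, s⟩ : ℂ)‖
    rw [← setIntegral_eq_integral_of_forall_compl_eq_zero (s := Set.Icc (-M) M)
      (f := fun s : ℝ => ψ ‖(⟨v, s⟩ : ℂ)‖), ← integral_const_mul]
    · exact setIntegral_congr_fun measurableSet_Icc fun s _ => fderiv_radial_apply_one hq hrad hv s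
    · intro s hs
      refine hψ0 _ (lt_of_lt_of_le ?_ (Complex.abs_im_le_norm _))
      rw [Set.mem_Icc, ← abs_le, not_le] at hs
      exact hs
  have hG' : ∀ u : ℝ, u ≠ 0 → deriv G u =
      Real.cosh (u / 2) • ((2 * Real.sinh (u / 2) : ℝ) * J (2 * Real.sinh (u / 2))) := by
    intro u hu
    have hs : 2 * Real.sinh (u / 2) ≠ 0 := by simpa [Real.sinh_eq_zero] using hu
    rw [show G = _ from funext hG, ← hK' _ hs]
    exact ((hK _).scomp u (hasDerivAt_two_mul_sinh_half u)).deriv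
  have hstep : ∫ u in Set.Ioi (0 : ℝ), (deriv G (-u) - deriv G u) *
      ((Real.sinh (u / 2) : ℝ) : ℂ)⁻¹ =
      ∫ u in Set.Ioi (0 : ℝ), -4 * (Real.cosh (u / 2) • J (2 * Real.sinh (u / 2))) := by
    refine setIntegral_congr_fun measurableSet_Ioi fun u hu => ?_
    have hu0 : u ≠ 0 := (Set.mem_Ioi.1 hu).ne'
    have hs : ((Real.sinh (u / 2) : ℝ) : ℂ) ≠ 0 := by
      exact_mod_cast (by simpa [Real.sinh_eq_zero] using hu0 : Real.sinh (u / 2) ≠ 0)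
    rw [hG' u hu0, hG' (-u) (neg_ne_zero.2 hu0), neg_div, Real.cosh_neg, Real.sinh_neg, mul_neg,
      hJeven]
    simp only [Complex.real_smul, ofReal_neg, ofReal_mul, ofReal_ofNat]
    field_simp
    ring
  rw [hstep, integral_const_mul, integral_comp_two_mul_sinh_half]
  rw [integral_eq_two_mul_integral_Ioi hJint hJeven] at hJtot
  linear_combination -2 * hJtot

theorem exists_forall_eq_zero_of_tsupport_subset {f : ℂ → ℂ} (hfc : HasCompactSupport f)
    (hsupp : ∀ w ∈ tsupport f, ‖w‖ < 1) :
    ∃ M : ℝ, 0 ≤ M ∧ ∀ w, M ^ 2 + 4 ≤ 4 / (1 - ‖w‖ ^ 2) → f w = 0 := by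
  have hcont : ContinuousOn (fun w : ℂ => 4 / (1 - ‖w‖ ^ 2)) (tsupport f) := by
    refine ContinuousOn.div (by fun_prop) (by fun_prop) fun w hw => ?_
    nlinarith [hsupp w hw, norm_nonneg w]
  obtain ⟨C, hC⟩ := hfc.isCompact.exists_bound_of_continuousOn hcont
  refine ⟨|C|, abs_nonneg C, fun w hw => ?_⟩
  by_contra hne
  have h1 := (le_abs_self _).trans (hC w (subset_tsupport f hne))
  nlinarith [le_abs_self C, sq_nonneg (|C| - 1)]

theorem four_div_one_sub_norm_horo_sq (p : ℂ) :
    4 / (1 - ‖horo p‖ ^ 2) = p.im ^ 2 + (2 * Real.sinh (p.re / 2)) ^ 2 + 4 := by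
  have := normSq_pos.2 (horoDen_ne_zero p)
  rw [one_sub_norm_horo_sq, ← normSq_horoDen]
  field_simp

theorem abs_le_abs_two_mul_sinh_half (u : ℝ) : |u| ≤ |2 * Real.sinh (u / 2)| := by
  rcases le_total 0 u with h | h
  · have h1 : u / 2 ≤ Real.sinh (u / 2) := Real.self_le_sinh_iff.2 (by linarith)
    rw [abs_of_nonneg h]
    exact le_trans (by linarith) (le_abs_self _)
  · have h1 : Real.sinh (u / 2) ≤ u / 2 := Real.sinh_le_self_iff.2 (by linarith)
    rw [abs_of_nonpos h]
    exact le_trans (by linarith) (neg_le_abs _)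

/-- The contraction of the plane onto the unit disc which intertwines radial functions in
horocyclic coordinates. -/
def diskMap (p : ℂ) : ℂ := p * ((√(‖p‖ ^ 2 + 4))⁻¹ : ℝ)

theorem norm_diskMap_sq (p : ℂ) : ‖diskMap p‖ ^ 2 = ‖p‖ ^ 2 / (‖p‖ ^ 2 + 4) := by
  rw [diskMap, norm_mul, mul_pow, Complex.norm_real, Real.norm_eq_abs, sq_abs, inv_pow,
    Real.sq_sqrt (by positivity), div_eq_mul_inv]

theorem four_div_one_sub_norm_diskMap_sq (p : ℂ) :
    4 / (1 - ‖diskMap p‖ ^ 2) = ‖p‖ ^ 2 + 4 := by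
  have : ‖p‖ ^ 2 + 4 ≠ 0 := by positivity
  rw [norm_diskMap_sq, one_sub_div this]
  field_simp
  ring

theorem contDiff_diskMap : ContDiff ℝ (⊤ : ℕ∞) diskMap := by
  refine contDiff_id.mul (ofRealCLM.contDiff.comp (ContDiff.inv (ContDiff.sqrt ?_ ?_) ?_))
  · exact (contDiff_norm_sq ℝ).add contDiff_const
  · intro p
    positivity
  · intro p
    positivity

theorem norm_horo_eq_norm_diskMap (p : ℂ) :
    ‖horo p‖ = ‖diskMap ⟨2 * Real.sinh (p.re / 2), p.im⟩‖ := by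
  rw [← sq_eq_sq₀ (norm_nonneg _) (norm_nonneg _), norm_horo_sq, norm_diskMap_sq,
    ← normSq_eq_norm_sq, normSq_mk]
  ring_nf

theorem integral_circle_mul_right_eq (f : ℂ → ℂ) {w w' : ℂ} (h : ‖w‖ = ‖w'‖) :
    ∫ θ in (0 : ℝ)..2 * π, f (cexp (θ * I) * w) = ∫ θ in (0 : ℝ)..2 * π, f (cexp (θ * I) * w') := by
  have hpol : ∀ v : ℂ, ∃ c : ℂ, ‖c‖ = 1 ∧ v = c * (‖v‖ : ℝ) := fun v => by
    refine ⟨cexp (v.arg * I), Complex.norm_exp_ofReal_mul_I _, ?_⟩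
    rw [mul_comm, Complex.norm_mul_exp_arg_mul_I]
  have hkey : ∀ v : ℂ, ∫ θ in (0 : ℝ)..2 * π, f (cexp (θ * I) * v) =
      ∫ θ in (0 : ℝ)..2 * π, f (cexp (θ * I) * (‖v‖ : ℝ)) := fun v => by
    obtain ⟨c, hc, hv⟩ := hpol v
    rw [← integral_circle_mul_left hc fun b => f (b * (‖v‖ : ℝ))]
    refine intervalIntegral.integral_congr fun θ _ => ?_
    nth_rewrite 1 [hv]
    ring_nf
  rw [hkey w, hkey w', h]

theorem hasDerivAt_intervalIntegral_param {F : ℝ × ℝ → ℂ} (hF : ContDiff ℝ 1 F) (a b u : ℝ) :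
    HasDerivAt (fun u => ∫ t in a..b, F (u, t)) (∫ t in a..b, fderiv ℝ F (u, t) (1, 0)) u := by
  convert! (hasFDerivAt_intervalIntegral_param hF a b u).hasDerivAt using 1
  rw [ContinuousLinearMap.intervalIntegral_apply]
  · rfl
  · refine Continuous.intervalIntegrable ?_ _ _
    exact (((hF.continuous_fderiv one_ne_zero).comp (Continuous.prodMk_right u)).clm_comp
      continuous_const)

theorem integral_integral_deriv_swap {G : ℝ × ℝ → ℂ} (hG : ContDiff ℝ (⊤ : ℕ∞) G) {M T : ℝ}
    (hM0 : 0 ≤ M) (hT : 0 ≤ T) (hM : ∀ u θ, M ≤ |u| → G (u, θ) = 0) :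
    ∫ θ in (0 : ℝ)..T, ∫ u in Set.Ioi (0 : ℝ),
        (deriv (fun u => G (u, θ)) (-u) - deriv (fun u => G (u, θ)) u) *
          ((Real.sinh (u / 2) : ℝ) : ℂ)⁻¹ =
      ∫ u in Set.Ioi (0 : ℝ),
        (deriv (fun u => ∫ θ in (0 : ℝ)..T, G (u, θ)) (-u) -
          deriv (fun u => ∫ θ in (0 : ℝ)..T, G (u, θ)) u) * ((Real.sinh (u / 2) : ℝ) : ℂ)⁻¹ := by
  set D : ℝ × ℝ → ℂ := fun x => fderiv ℝ G x (1, 0) with hD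
  have hDs : ContDiff ℝ (⊤ : ℕ∞) D :=
    (hG.fderiv_right (m := (⊤ : ℕ∞)) (by simp)).clm_apply contDiff_const
  have hderiv : ∀ u θ, deriv (fun u => G (u, θ)) u = D (u, θ) := fun u θ => by
    have hline : HasDerivAt (fun t : ℝ => (t, θ)) ((1 : ℝ), (0 : ℝ)) u :=
      (hasDerivAt_id u).prodMk (hasDerivAt_const u θ)
    exact (((hG.differentiable (by simp) (u, θ)).hasFDerivAt).comp_hasDerivAt u hline).deriv
  have hD0 : ∀ u θ, M < |u| → D (u, θ) = 0 := fun u θ hu => by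
    rw [← hderiv]
    have : (fun u => G (u, θ)) =ᶠ[nhds u] fun _ => 0 := by
      filter_upwards [continuous_abs.continuousAt.eventually (lt_mem_nhds hu)] with x hx
      exact hM _ _ hx.le
    rw [this.deriv_eq, deriv_const]
  have hderivI : ∀ u, deriv (fun u => ∫ θ in (0 : ℝ)..T, G (u, θ)) u =
      ∫ θ in (0 : ℝ)..T, D (u, θ) := fun u =>
    (hasDerivAt_intervalIntegral_param (hG.of_le (by simp)) 0 T u).deriv
  simp only [hderiv, hderivI]
  set H : ℝ × ℝ → ℂ := fun x => D (-x.1, x.2) - D x with hH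
  have hHs : ContDiff ℝ (⊤ : ℕ∞) H :=
    (hDs.comp (contDiff_fst.neg.prodMk contDiff_snd)).sub hDs
  have hK : IsCompact (Set.Icc 0 M ×ˢ Set.Icc 0 T) := isCompact_Icc.prod isCompact_Icc
  obtain ⟨C, hC⟩ := hK.exists_bound_of_continuousOn
    (hHs.continuous_fderiv (by simp)).continuousOn
  have hbound : ∀ u ∈ Set.Ioc 0 M, ∀ θ ∈ Set.Ioc 0 T, ‖H (u, θ)‖ ≤ C * u := by
    intro u hu θ hθ
    have h := ((convex_Icc 0 M).prod (convex_Icc 0 T)).norm_image_sub_le_of_norm_fderiv_le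
      (𝕜 := ℝ) (f := H) (fun x _ => hHs.differentiable (by simp) x) hC
      (x := (0, θ)) (y := (u, θ)) ⟨⟨le_rfl, hM0⟩, ⟨hθ.1.le, hθ.2⟩⟩
      ⟨⟨hu.1.le, hu.2⟩, ⟨hθ.1.le, hθ.2⟩⟩
    have h0 : H (0, θ) = 0 := by simp [hH]
    simpa [h0, Prod.norm_def, abs_of_pos hu.1, hu.1.le] using h
  have hinteg : IntegrableOn (fun x : ℝ × ℝ => H (x.2, x.1) * ((Real.sinh (x.2 / 2) : ℝ) : ℂ)⁻¹)
      (Set.Ioc 0 T ×ˢ Set.Ioi 0) := by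
    refine IntegrableOn.of_forall_sdiff_eq_zero (s := Set.Ioc 0 T ×ˢ Set.Ioc 0 M) ?_
      (measurableSet_Ioc.prod measurableSet_Ioi) ?_
    · refine Measure.integrableOn_of_bounded (M := 2 * C) ?_ ?_ ?_
      · exact ((Metric.isBounded_Ioc 0 T).prod (Metric.isBounded_Ioc 0 M)).measure_lt_top.ne
      · have h1 : Measurable fun x : ℝ × ℝ => H (x.2, x.1) :=
          (hHs.continuous.comp continuous_swap).measurable
        have h2 : Measurable fun x : ℝ × ℝ => ((Real.sinh (x.2 / 2) : ℝ) : ℂ) := by fun_prop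
        exact (h1.mul h2.inv).aestronglyMeasurable
      · refine (ae_restrict_mem (measurableSet_Ioc.prod measurableSet_Ioc)).mono ?_
        rintro ⟨θ, u⟩ ⟨hθ, hu⟩
        have h1 := hbound u hu θ hθ
        have hs : u / 2 ≤ Real.sinh (u / 2) := Real.self_le_sinh_iff.2 (by linarith [hu.1])
        have hu0 : 0 < u := hu.1
        simp only [norm_mul, norm_inv, Complex.norm_real, Real.norm_eq_abs]
        rw [abs_of_pos (by linarith), ← div_eq_mul_inv, div_le_iff₀ (by linarith)]
        have hC0 : 0 ≤ C := by
          by_contra! hneg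
          nlinarith [norm_nonneg (H (u, θ))]
        nlinarith
    · rintro ⟨θ, u⟩ ⟨⟨hθ, hu⟩, hnot⟩
      have hu0 : 0 < u := hu
      have hu1 : M < u := by
        by_contra! hle
        exact hnot ⟨hθ, hu0, hle⟩
      simp only [hH]
      rw [hD0 u θ (by rwa [abs_of_pos hu0]), hD0 (-u) θ (by rwa [abs_neg, abs_of_pos hu0])]
      simp
  rw [intervalIntegral_integral_swap]
  · refine setIntegral_congr_fun measurableSet_Ioi fun u _ => ?_
    rw [intervalIntegral.integral_mul_const, intervalIntegral.integral_sub]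
    · exact (hDs.continuous.comp (Continuous.prodMk_right (-u))).intervalIntegrable _ _
    · exact (hDs.continuous.comp (Continuous.prodMk_right u)).intervalIntegrable _ _
  · rw [Set.uIoc_of_le hT, Measure.prod_restrict]
    exact hinteg

theorem integral_mul_Pk_cpow_eq_fourier {f : ℂ → ℂ} (hf : Continuous f) {M : ℝ}
    (hM0 : 0 ≤ M) (hM : ∀ w, M ^ 2 + 4 ≤ 4 / (1 - ‖w‖ ^ 2) → f w = 0)
    {b : ℂ} (hb : ‖b‖ = 1) (r : ℝ) :
    ∫ w, f w * (Pk w b : ℂ) ^ ((1 : ℂ) / 2 + I * r) ∂hypVol =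
      ∫ u : ℝ, cexp (I * r * u) * ∫ s in (-M)..M, f (b * horo ⟨u, s⟩) := by
  have hzero : ∀ p : ℂ, M ≤ |p.re| ∨ M ≤ |p.im| → f (b * horo p) = 0 := fun p hp => by
    refine hM _ ?_
    rw [norm_mul, hb, one_mul, four_div_one_sub_norm_horo_sq]
    have h1 := abs_le_abs_two_mul_sinh_half p.re
    rw [← sq_abs p.im, ← sq_abs (2 * Real.sinh (p.re / 2))]
    rcases hp with hp | hp
    · nlinarith [sq_nonneg |p.im|]
    · nlinarith [sq_nonneg |2 * Real.sinh (p.re / 2)|]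
  set F : ℂ → ℂ := fun p => cexp (I * r * p.re) * f (b * horo p) with hF
  have hFc : Continuous F := by
    have : Continuous horo := contDiff_horo.continuous
    fun_prop
  have hFs : HasCompactSupport F := by
    refine HasCompactSupport.intro (isCompact_closedBall (0 : ℂ) (M + M)) fun p hp => ?_
    rw [mem_closedBall_zero_iff, not_le] at hp
    have : M ≤ |p.re| ∨ M ≤ |p.im| := by
      by_contra! h
      linarith [Complex.norm_le_abs_re_add_abs_im p]
    simp only [hF, hzero p this, mul_zero]
  have hFi : Integrable F := hFc.integrable_of_hasCompactSupport hFs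
  have hFi2 : Integrable (fun x : ℝ × ℝ => F ⟨x.1, x.2⟩) (volume.prod volume) :=
    Complex.volume_preserving_equiv_real_prod.symm.integrable_comp_emb
      measurableEquivRealProd.symm.measurableEmbedding |>.2 hFi
  have hPk : ∀ w, Pk (b * w) b = Pk w 1 := fun w => by
    simpa using Pk_mul_left (w := w) (b := 1) hb
  calc ∫ w, f w * (Pk w b : ℂ) ^ ((1 : ℂ) / 2 + I * r) ∂hypVol
      = ∫ w, f (b * w) * (Pk w 1 : ℂ) ^ ((1 : ℂ) / 2 + I * r) ∂hypVol := by
        rw [← integral_hypVol_mul_left hb fun w => f w * (Pk w b : ℂ) ^ ((1 : ℂ) / 2 + I * r)]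
        simp only [hPk]
    _ = ∫ p : ℂ, F p := by
        rw [integral_hypVol_eq_horo]
        refine integral_congr_ae (.of_forall fun p => ?_)
        simp only [Pk_horo_one, hF]
        rw [Complex.cpow_def_of_ne_zero (by exact_mod_cast Real.exp_ne_zero _),
          ← Complex.ofReal_log (Real.exp_pos _).le, Real.log_exp, Complex.ofReal_exp,
          mul_comm (f _), ← mul_assoc, ← Complex.exp_add]
        congr 2
        push_cast
        ring
    _ = ∫ x : ℝ × ℝ, F ⟨x.1, x.2⟩ :=
        (Complex.volume_preserving_equiv_real_prod.symm.integral_comp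
          measurableEquivRealProd.symm.measurableEmbedding F).symm
    _ = ∫ u : ℝ, ∫ s : ℝ, F ⟨u, s⟩ := integral_prod _ hFi2
    _ = _ := by
        refine integral_congr_ae (.of_forall fun u => ?_)
        simp only [hF, integral_const_mul]
        congr 1
        rw [intervalIntegral.integral_of_le (by linarith), ← integral_Icc_eq_integral_Ioc,
          setIntegral_eq_integral_of_forall_compl_eq_zero]
        intro s hs
        rw [Set.mem_Icc, ← abs_le, not_le] at hs
        exact hzero _ (.inr hs.le)

/-- Fourier inversion on the hyperbolic disc, evaluated at the origin. -/
theorem integral_integral_fourier_zero {f : ℂ → ℂ} (hf : ContDiff ℝ (⊤ : ℕ∞) f)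
    (hfc : HasCompactSupport f) (hsupp : ∀ w ∈ tsupport f, ‖w‖ < 1) :
    ∫ b, (∫ r : ℝ, (∫ w, f w * (Pk w b : ℂ) ^ ((1 : ℂ) / 2 + I * r) ∂hypVol) *
      ((r * Real.tanh (π * r) : ℝ) : ℂ)) ∂circleMeasure = 4 * π * f 0 := by
  obtain ⟨M, hM0, hM⟩ := exists_forall_eq_zero_of_tsupport_subset hfc hsupp
  have hπ : (0 : ℝ) ≤ 2 * π := by positivity
  have hexp : ContDiff ℝ (⊤ : ℕ∞) fun θ : ℝ => cexp (θ * I) :=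
    (ofRealCLM.contDiff.mul contDiff_const).cexp
  have hnorm : ∀ θ : ℝ, ‖cexp (θ * I)‖ = 1 := fun θ => Complex.norm_exp_ofReal_mul_I θ
  set g : (ℝ × ℝ) × ℝ → ℂ := fun x => f (cexp (x.1.2 * I) * horo ⟨x.1.1, x.2⟩) with hg
  have hgs : ContDiff ℝ (⊤ : ℕ∞) g := by
    have hmk : ContDiff ℝ (⊤ : ℕ∞) fun x : (ℝ × ℝ) × ℝ => (⟨x.1.1, x.2⟩ : ℂ) :=
      equivRealProdCLM.symm.contDiff.comp (contDiff_fst.fst.prodMk contDiff_snd)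
    exact hf.comp ((hexp.comp contDiff_fst.snd).mul (contDiff_horo.comp hmk))
  set G : ℝ × ℝ → ℂ := fun x => ∫ s in (-M)..M, g (x, s) with hG
  have hGs : ContDiff ℝ (⊤ : ℕ∞) G := contDiff_infty_intervalIntegral_param hgs (-M) M
  have hGM : ∀ u θ, M ≤ |u| → G (u, θ) = 0 := fun u θ hu => by
    rw [hG]
    simp only
    rw [intervalIntegral.integral_congr (g := fun _ => (0 : ℂ)), intervalIntegral.integral_zero]
    intro s _
    refine hM _ ?_
    rw [norm_mul, hnorm, one_mul, four_div_one_sub_norm_horo_sq]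
    have h1 := abs_le_abs_two_mul_sinh_half u
    simp only
    rw [← sq_abs (2 * Real.sinh (u / 2))]
    nlinarith [sq_nonneg s]
  set q : ℂ → ℂ := fun p => ∫ θ in (0 : ℝ)..2 * π, f (cexp (θ * I) * diskMap p) with hq
  have hqs : ContDiff ℝ (⊤ : ℕ∞) q :=
    contDiff_infty_intervalIntegral_param (f := fun x : ℂ × ℝ => f (cexp (x.2 * I) * diskMap x.1))
      (hf.comp ((hexp.comp contDiff_snd).mul (contDiff_diskMap.comp contDiff_fst))) 0 (2 * π)
  have hqrad : ∀ p p', ‖p‖ = ‖p'‖ → q p = q p' := fun p p' h => by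
    refine integral_circle_mul_right_eq f ?_
    rw [← sq_eq_sq₀ (norm_nonneg _) (norm_nonneg _), norm_diskMap_sq, norm_diskMap_sq, h]
  have hqM : ∀ p, M ≤ ‖p‖ → q p = 0 := fun p hp => by
    rw [hq]
    simp only
    rw [intervalIntegral.integral_congr (g := fun _ => (0 : ℂ)), intervalIntegral.integral_zero]
    intro θ _
    refine hM _ ?_
    rw [norm_mul, hnorm, one_mul, four_div_one_sub_norm_diskMap_sq]
    nlinarith
  have hq0 : q 0 = 2 * π * f 0 := by
    simp [hq, diskMap]
  have hGq : ∀ u, ∫ θ in (0 : ℝ)..2 * π, G (u, θ) =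
      ∫ s in (-M)..M, q ⟨2 * Real.sinh (u / 2), s⟩ := fun u => by
    have hc : Continuous fun x : ℝ × ℝ => g ((u, x.1), x.2) :=
      hgs.continuous.comp (by fun_prop)
    rw [hG]
    simp only
    rw [intervalIntegral_intervalIntegral_swap (F := fun θ s => g ((u, θ), s))]
    · refine intervalIntegral.integral_congr fun s _ => ?_
      exact integral_circle_mul_right_eq f (norm_horo_eq_norm_diskMap ⟨u, s⟩)
    · exact (hc.continuousOn.integrableOn_compact (isCompact_uIcc.prod isCompact_uIcc)).mono_set
        (Set.prod_mono Set.uIoc_subset_uIcc Set.uIoc_subset_uIcc)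
  have hinner : ∀ θ : ℝ, ∫ r : ℝ, (∫ w, f w *
      (Pk w (cexp (θ * I)) : ℂ) ^ ((1 : ℂ) / 2 + I * r) ∂hypVol) *
        ((r * Real.tanh (π * r) : ℝ) : ℂ) =
      ∫ u in Set.Ioi (0 : ℝ), (deriv (fun u => G (u, θ)) (-u) - deriv (fun u => G (u, θ)) u) *
        ((Real.sinh (u / 2) : ℝ) : ℂ)⁻¹ := fun θ => by
    simp only [integral_mul_Pk_cpow_eq_fourier hf.continuous hM0 hM (hnorm θ)]
    refine integral_fourier_mul_tanh (G := fun u => G (u, θ))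
      (hGs.comp (contDiff_id.prodMk contDiff_const)) ?_
    refine HasCompactSupport.intro (isCompact_closedBall (0 : ℝ) M) fun u hu => hGM u θ ?_
    rw [mem_closedBall_zero_iff, not_le] at hu
    exact hu.le
  rw [integral_circleMeasure, ← intervalIntegral.integral_of_le hπ]
  simp only [hinner]
  rw [integral_integral_deriv_swap hGs hM0 hπ hGM,
    integral_deriv_abel_radial hqs hqrad hM0 hqM hGq, hq0, Complex.real_smul]
  have : (π : ℂ) ≠ 0 := by exact_mod_cast Real.pi_ne_zero
  push_cast
  field_simp

theorem integral_hypVol_congr {F F' : ℂ → ℂ} (h : ∀ w, ‖w‖ < 1 → F w = F' w) :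
    ∫ w, F w ∂hypVol = ∫ w, F' w ∂hypVol := by
  rw [integral_hypVol, integral_hypVol]
  refine setIntegral_congr_fun Metric.isOpen_ball.measurableSet fun w hw => ?_
  rw [h w (mem_ball_zero_iff.1 hw)]

theorem integral_circleMeasure_congr {g g' : ℂ → ℂ} (h : ∀ b, ‖b‖ = 1 → g b = g' b) :
    ∫ b, g b ∂circleMeasure = ∫ b, g' b ∂circleMeasure := by
  rw [integral_circleMeasure, integral_circleMeasure]
  simp only [h _ (Complex.norm_exp_ofReal_mul_I _)]

theorem Pk_pos {w b : ℂ} (hw : ‖w‖ < 1) (hb : ‖b‖ = 1) : 0 < Pk w b := by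
  have h1 : 0 < ‖w - b‖ := norm_pos_iff.2 (sub_ne_zero.2 fun h => by rw [h] at hw; linarith)
  have h2 : 0 < 1 - ‖w‖ ^ 2 := by nlinarith [norm_nonneg w]
  rw [Pk]
  positivity

theorem contDiffAt_Pk_cpow {w b : ℂ} (hw : ‖w‖ < 1) (hb : ‖b‖ = 1) (s : ℂ) :
    ContDiffAt ℝ (⊤ : ℕ∞) (fun w => (Pk w b : ℂ) ^ s) w := by
  have hP : ContDiffAt ℝ (⊤ : ℕ∞) (fun w => Pk w b) w := by
    refine ContDiffAt.div ?_ ?_ ?_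
    · exact contDiffAt_const.sub (contDiff_norm_sq ℝ).contDiffAt
    · exact (contDiff_id.sub contDiff_const).contDiffAt.norm_sq ℝ
    · exact pow_ne_zero 2 (norm_ne_zero_iff.2 (sub_ne_zero.2 fun h => by rw [h] at hw; linarith))
  have h : ContDiffAt ℝ (⊤ : ℕ∞) (fun w => cexp ((Real.log (Pk w b) : ℝ) * s)) w :=
    ((ofRealCLM.contDiff.contDiffAt.comp w (hP.log (Pk_pos hw hb).ne')).mul contDiffAt_const).cexp
  refine h.congr_of_eventuallyEq ?_
  filter_upwards [Metric.isOpen_ball.mem_nhds (mem_ball_zero_iff.2 hw)] with v hv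
  have hv' := Pk_pos (mem_ball_zero_iff.1 hv) hb
  rw [Complex.cpow_def_of_ne_zero (by exact_mod_cast hv'.ne'), Complex.ofReal_log hv'.le]

theorem contDiff_indicator_comp_mob {f : ℂ → ℂ} {z : ℂ} (hz : ‖z‖ < 1) {K : Set ℂ}
    (hK : IsCompact K) (hKball : K ⊆ Metric.ball 0 1) (hf0 : ∀ w, w ∉ K → f w = 0)
    (hf : ∀ w, ‖w‖ < 1 → ContDiffAt ℝ (⊤ : ℕ∞) f w) :
    ContDiff ℝ (⊤ : ℕ∞) ((Metric.ball (0 : ℂ) 1).indicator fun w => f (mob z w)) ∧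
      HasCompactSupport ((Metric.ball (0 : ℂ) 1).indicator fun w => f (mob z w)) ∧
      ∀ w ∈ tsupport ((Metric.ball (0 : ℂ) 1).indicator fun w => f (mob z w)), ‖w‖ < 1 := by
  have hz' : ‖-z‖ < 1 := by rwa [norm_neg]
  have hmob : ∀ v, ‖v‖ < 1 → ∀ w, ‖w‖ < 1 → ContDiffAt ℝ (⊤ : ℕ∞) (mob v) w := fun v hv w hw => by
    have h : mob v = fun w => (w + v) * (1 + starRingEnd ℂ v * w)⁻¹ :=
      funext fun w => div_eq_mul_inv _ _
    rw [h]
    exact (contDiffAt_id.add contDiffAt_const).mul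
      ((contDiffAt_const.add (contDiffAt_const.mul contDiffAt_id)).inv
        (mob_den_ne_zero hv hw.le))
  set K' := mob (-z) '' K with hK'
  have hK'c : IsCompact K' := hK.image_of_continuousOn fun w hw =>
    (hmob _ hz' w (mem_ball_zero_iff.1 (hKball hw))).continuousAt.continuousWithinAt
  have hK'ball : K' ⊆ Metric.ball 0 1 := by
    rintro _ ⟨w, hw, rfl⟩
    exact mem_ball_zero_iff.2 (norm_mob_lt_one hz' (mem_ball_zero_iff.1 (hKball hw)))
  set g := (Metric.ball (0 : ℂ) 1).indicator fun w => f (mob z w) with hg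
  have hg0 : ∀ w, w ∉ K' → g w = 0 := fun w hw => by
    by_cases hwb : w ∈ Metric.ball (0 : ℂ) 1
    · rw [hg, Set.indicator_of_mem hwb]
      refine hf0 _ fun hmem => hw ⟨_, hmem, mob_neg_mob hz (mem_ball_zero_iff.1 hwb).le⟩
    · rw [hg, Set.indicator_of_notMem hwb]
  have hgt : tsupport g ⊆ K' :=
    closure_minimal (fun w hw => by_contra fun h => hw (hg0 w h)) hK'c.isClosed
  refine ⟨contDiff_iff_contDiffAt.2 fun w => ?_, hK'c.of_isClosed_subset (isClosed_tsupport g) hgt,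
    fun w hw => mem_ball_zero_iff.1 (hK'ball (hgt hw))⟩
  by_cases hwb : w ∈ Metric.ball (0 : ℂ) 1
  · have hw1 := mem_ball_zero_iff.1 hwb
    refine ((hf _ (norm_mob_lt_one hz hw1)).comp w (hmob z hz w hw1)).congr_of_eventuallyEq ?_
    filter_upwards [Metric.isOpen_ball.mem_nhds hwb] with v hv
    rw [hg, Set.indicator_of_mem hv]
    rfl
  · refine (contDiffAt_const (c := (0 : ℂ))).congr_of_eventuallyEq ?_
    filter_upwards [hK'c.isClosed.isOpen_compl.mem_nhds fun h => hwb (hK'ball h)] with v hv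
    exact hg0 v hv

/-- Fourier inversion on the hyperbolic disc. -/
theorem integral_integral_fourier {f : ℂ → ℂ} {z : ℂ} (hz : ‖z‖ < 1) {K : Set ℂ}
    (hK : IsCompact K) (hKball : K ⊆ Metric.ball 0 1) (hf0 : ∀ w, w ∉ K → f w = 0)
    (hf : ∀ w, ‖w‖ < 1 → ContDiffAt ℝ (⊤ : ℕ∞) f w) :
    ∫ b, (∫ r : ℝ, (Pk z b : ℂ) ^ ((1 : ℂ) / 2 - I * r) *
        (∫ w, f w * (Pk w b : ℂ) ^ ((1 : ℂ) / 2 + I * r) ∂hypVol) *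
      ((r * Real.tanh (π * r) : ℝ) : ℂ)) ∂circleMeasure = 4 * π * f z := by
  obtain ⟨hg, hgc, hgs⟩ := contDiff_indicator_comp_mob hz hK hKball hf0 hf
  have h0 := integral_integral_fourier_zero hg hgc hgs
  have hmob0 : mob z 0 = z := by simp [mob]
  rw [Set.indicator_of_mem (Metric.mem_ball_self one_pos), hmob0] at h0
  set J : ℂ → ℂ := fun b => ∫ r : ℝ, (Pk z b : ℂ) ^ (-((1 : ℂ) / 2 + I * r)) *
    (∫ w, f w * (Pk w b : ℂ) ^ ((1 : ℂ) / 2 + I * r) ∂hypVol) *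
      ((r * Real.tanh (π * r) : ℝ) : ℂ) with hJ
  rw [← h0]
  calc _ = ∫ b, Pk z b * J b ∂circleMeasure := by
        refine integral_circleMeasure_congr fun b hb => ?_
        have hP : (Pk z b : ℂ) ≠ 0 := by exact_mod_cast (Pk_pos hz hb).ne'
        rw [hJ]
        simp only
        rw [← integral_const_mul]
        refine integral_congr_ae (.of_forall fun r => ?_)
        simp only
        rw [show (1 : ℂ) / 2 - I * r = 1 + -((1 : ℂ) / 2 + I * r) by ring,
          Complex.cpow_add _ _ hP, Complex.cpow_one]
        ring
    _ = ∫ b, J (mob z b) ∂circleMeasure := (integral_circleMeasure_mob hz J).symm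
    _ = _ := by
        refine integral_circleMeasure_congr fun b hb => ?_
        rw [hJ]
        refine integral_congr_ae (.of_forall fun r => ?_)
        simp only
        congr 1
        rw [← integral_mob hz, ← integral_const_mul]
        refine integral_hypVol_congr fun w hw => ?_
        have hPz := Pk_pos hz (norm_mob_eq_one hz hb)
        have hPw := Pk_pos hw hb
        rw [Set.indicator_of_mem (mem_ball_zero_iff.2 hw), Pk_mob hz hw hb, Complex.ofReal_mul,
          Complex.mul_cpow_ofReal_nonneg hPw.le hPz.le, Complex.cpow_neg]
        have : (Pk z (mob z b) : ℂ) ^ ((1 : ℂ) / 2 + I * r) ≠ 0 := by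
          rw [Ne, Complex.cpow_eq_zero_iff]
          exact fun h => hPz.ne' (by exact_mod_cast h.1)
        generalize (Pk z (mob z b) : ℂ) ^ ((1 : ℂ) / 2 + I * r) = X at this ⊢
        field_simp

/-- Inversion formula for the Wigner transform on the hyperbolic disc. -/
theorem wigner_transform_inversion
    (a : ℂ → ℂ → ℝ → ℂ)
    (hsm : ContDiff ℝ (⊤ : ℕ∞) fun p : ℂ × ℂ × ℝ => a p.1 p.2.1 p.2.2)
    (hcs : HasCompactSupport fun p : ℂ × ℂ × ℝ => a p.1 p.2.1 p.2.2)
    (hsupp : ∀ p ∈ tsupport (fun p : ℂ × ℂ × ℝ => a p.1 p.2.1 p.2.2), ‖p.1‖ < 1)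
    (Wa : ℝ → ℂ → ℝ → ℂ → ℂ)
    (hWa : ∀ (r : ℝ) (b : ℂ) (r' : ℝ) (b' : ℂ), Wa r b r' b' =
      ∫ z, a z b r * (Pk z b : ℂ) ^ ((1 : ℂ) / 2 + Complex.I * (r : ℂ)) *
        (Pk z b' : ℂ) ^ ((1 : ℂ) / 2 + Complex.I * (r' : ℂ)) ∂hypVol) :
    ∀ (z b : ℂ) (r : ℝ), ‖z‖ < 1 → ‖b‖ = 1 →
      a z b r = (Pk z b : ℂ) ^ (-((1 : ℂ) / 2 + Complex.I * (r : ℂ))) * (1 / 2) *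
        ∫ b', (∫ r' : ℝ,
            (Pk z b' : ℂ) ^ ((1 : ℂ) / 2 - Complex.I * (r' : ℂ)) * Wa r b r' b' *
              (((2 * Real.pi)⁻¹ * r' * Real.tanh (Real.pi * r') : ℝ) : ℂ))
          ∂circleMeasure := by
  intro z b r hz hb
  set s : ℂ := (1 : ℂ) / 2 + Complex.I * (r : ℂ) with hs
  set A : ℂ × ℂ × ℝ → ℂ := fun p => a p.1 p.2.1 p.2.2 with hA
  have ha : ContDiff ℝ (⊤ : ℕ∞) fun w : ℂ => a w b r :=
    hsm.comp (contDiff_id.prodMk (contDiff_const (c := (b, r))))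
  have hinv := integral_integral_fourier (f := fun w => a w b r * (Pk w b : ℂ) ^ s) hz
    (hcs.isCompact.image continuous_fst)
    (by
      rintro _ ⟨p, hp, rfl⟩
      exact mem_ball_zero_iff.2 (hsupp p hp))
    (fun w hw => by
      have : a w b r = 0 := by
        by_contra hne
        exact hw ⟨(w, b, r), subset_tsupport A hne, rfl⟩
      rw [this, zero_mul])
    (fun w hw => ha.contDiffAt.mul (contDiffAt_Pk_cpow hw hb s))
  have hWs : ∀ (r' : ℝ) (b' : ℂ), ∫ w, a w b r * (Pk w b : ℂ) ^ s *
      (Pk w b' : ℂ) ^ ((1 : ℂ) / 2 + Complex.I * (r' : ℂ)) ∂hypVol = Wa r b r' b' :=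
    fun r' b' => (hWa r b r' b').symm
  simp only [hWs] at hinv
  have hscale : ∀ b' : ℂ, (∫ r' : ℝ,
      (Pk z b' : ℂ) ^ ((1 : ℂ) / 2 - Complex.I * (r' : ℂ)) * Wa r b r' b' *
        (((2 * Real.pi)⁻¹ * r' * Real.tanh (Real.pi * r') : ℝ) : ℂ)) =
      (2 * π : ℂ)⁻¹ * ∫ r' : ℝ,
        (Pk z b' : ℂ) ^ ((1 : ℂ) / 2 - Complex.I * (r' : ℂ)) * Wa r b r' b' *
          ((r' * Real.tanh (Real.pi * r') : ℝ) : ℂ) := fun b' => by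
    rw [← integral_const_mul]
    refine integral_congr_ae (.of_forall fun r' => ?_)
    simp only
    push_cast
    ring
  have hP := Pk_pos hz hb
  have hPs : (Pk z b : ℂ) ^ s ≠ 0 := by
    rw [Ne, Complex.cpow_eq_zero_iff]
    exact fun h => hP.ne' (by exact_mod_cast h.1)
  have hπ : (π : ℂ) ≠ 0 := by exact_mod_cast Real.pi_ne_zero
  simp only [hscale]
  rw [integral_const_mul, hinv, Complex.cpow_neg]
  generalize (Pk z b : ℂ) ^ s = X at hPs ⊢
  field_simp
  norm_num
end
end

section
/- Let b ≠ b' be points of S¹ and let g₀ be an oriented-geodesic frame for (b', b). Then for all τ, u ∈ ℝ, log(|b − b'|/2) + log P((g₀ · A_τ · N_u)·0, b) = τ, where the matrix product is taken in SU(1,1); equivalently P((g₀ A_τ N_u)·0, b) = (2/|b−b'|) · e^τ. -/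
open Complex MeasureTheory Real

noncomputable section

/-- Möbius action of a 2×2 complex matrix on ℂ. -/
def moeb (g : Matrix (Fin 2) (Fin 2) ℂ) (w : ℂ) : ℂ :=
  (g 0 0 * w + g 0 1) / (g 1 0 * w + g 1 1)

/-- The predicate defining SU(1,1) matrices. -/
def IsSU11 (g : Matrix (Fin 2) (Fin 2) ℂ) : Prop :=
  g 1 0 = (starRingEnd ℂ) (g 0 1) ∧ g 1 1 = (starRingEnd ℂ) (g 0 0) ∧
    ‖g 0 0‖ ^ 2 - ‖g 0 1‖ ^ 2 = 1

/-- The geodesic-flow one-parameter subgroup of SU(1,1). -/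
def Amat (τ : ℝ) : Matrix (Fin 2) (Fin 2) ℂ :=
  !![(Real.cosh (τ / 2) : ℂ), (Real.sinh (τ / 2) : ℂ);
     (Real.sinh (τ / 2) : ℂ), (Real.cosh (τ / 2) : ℂ)]

/-- The horocycle-flow one-parameter subgroup of SU(1,1). -/
def Nmat (u : ℝ) : Matrix (Fin 2) (Fin 2) ℂ :=
  !![1 + (u : ℂ) * Complex.I / 2, -((u : ℂ) * Complex.I) / 2;
     (u : ℂ) * Complex.I / 2, 1 - (u : ℂ) * Complex.I / 2]

/-- `g₀` is an oriented-geodesic frame for the pair of boundary points `(b', b)`. -/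
def frameFor (g₀ : Matrix (Fin 2) (Fin 2) ℂ) (b' b : ℂ) : Prop :=
  IsSU11 g₀ ∧ moeb g₀ 1 = b ∧ moeb g₀ (-1) = b' ∧
    ‖moeb g₀ 0 - b‖ = ‖moeb g₀ 0 - b'‖

open ComplexConjugate

lemma IsSU11.mul_conj_sub {g : Matrix (Fin 2) (Fin 2) ℂ} (hg : IsSU11 g) :
    g 0 0 * conj (g 0 0) - g 0 1 * conj (g 0 1) = 1 := by
  rw [Complex.mul_conj', Complex.mul_conj']
  exact_mod_cast hg.2.2

lemma IsSU11.mul {g h : Matrix (Fin 2) (Fin 2) ℂ} (hg : IsSU11 g) (hh : IsSU11 h) :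
    IsSU11 (g * h) := by
  have dg := hg.mul_conj_sub
  have dh := hh.mul_conj_sub
  obtain ⟨hg₁, hg₂, -⟩ := hg
  obtain ⟨hh₁, hh₂, -⟩ := hh
  refine ⟨?_, ?_, ?_⟩
  · simp only [Matrix.mul_apply, Fin.sum_univ_two, hg₁, hg₂, hh₁, hh₂, map_add, map_mul,
      Complex.conj_conj]
    ring
  · simp only [Matrix.mul_apply, Fin.sum_univ_two, hg₁, hg₂, hh₁, hh₂, map_add, map_mul,
      Complex.conj_conj]
    ring
  · apply Complex.ofReal_injective
    push_cast
    rw [← Complex.mul_conj', ← Complex.mul_conj']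
    simp only [Matrix.mul_apply, Fin.sum_univ_two, hh₁, hh₂, map_add, map_mul,
      Complex.conj_conj]
    linear_combination (h 0 0 * conj (h 0 0) - h 0 1 * conj (h 0 1)) * dg + dh

lemma isSU11_Amat (τ : ℝ) : IsSU11 (Amat τ) := by
  refine ⟨?_, ?_, ?_⟩
  · simp only [Amat, Matrix.of_apply, Matrix.cons_val', Matrix.cons_val_zero,
      Matrix.cons_val_one, Matrix.cons_val_fin_one, Complex.conj_ofReal]
  · simp only [Amat, Matrix.of_apply, Matrix.cons_val', Matrix.cons_val_zero,
      Matrix.cons_val_one, Matrix.cons_val_fin_one, Complex.conj_ofReal]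
  · simp only [Amat, Matrix.of_apply, Matrix.cons_val', Matrix.cons_val_zero,
      Matrix.cons_val_one, Matrix.cons_val_fin_one, Complex.norm_real, Real.norm_eq_abs, sq_abs]
    exact Real.cosh_sq_sub_sinh_sq _

lemma isSU11_Nmat (u : ℝ) : IsSU11 (Nmat u) := by
  refine ⟨?_, ?_, ?_⟩
  · simp [Nmat, Complex.conj_ofNat]
  · simp [Nmat, Complex.conj_ofNat]
    ring
  · apply Complex.ofReal_injective
    push_cast
    rw [← Complex.mul_conj', ← Complex.mul_conj']
    simp [Nmat, Complex.conj_ofNat]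
    ring

lemma mul_Amat_mul_Nmat_row_sum (g : Matrix (Fin 2) (Fin 2) ℂ) (τ u : ℝ) (i : Fin 2) :
    (g * Amat τ * Nmat u) i 0 + (g * Amat τ * Nmat u) i 1 =
      (Real.exp (τ / 2) : ℂ) * (g i 0 + g i 1) := by
  simp [Matrix.mul_apply, Fin.sum_univ_two, Amat, Nmat]
  linear_combination (g i 0 + g i 1) * Complex.cosh_add_sinh ((τ : ℂ) / 2)

lemma IsSU11.norm_sub_pos {g : Matrix (Fin 2) (Fin 2) ℂ} (hg : IsSU11 g) :
    0 < ‖g 0 0 + g 0 1‖ ∧ 0 < ‖g 0 0 - g 0 1‖ ∧ 0 < ‖g 0 0‖ := by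
  have d := hg.2.2
  refine ⟨?_, ?_, ?_⟩
  · refine norm_pos_iff.2 fun h => ?_
    rw [eq_neg_of_add_eq_zero_left h, norm_neg] at d
    norm_num at d
  · refine norm_pos_iff.2 fun h => ?_
    rw [sub_eq_zero.1 h] at d
    norm_num at d
  · refine norm_pos_iff.2 fun h => ?_
    rw [h, norm_zero] at d
    nlinarith [sq_nonneg ‖g 0 1‖]

lemma IsSU11.norm_denom {g : Matrix (Fin 2) (Fin 2) ℂ} (hg : IsSU11 g) :
    ‖g 1 0 + g 1 1‖ = ‖g 0 0 + g 0 1‖ ∧ ‖-g 1 0 + g 1 1‖ = ‖g 0 0 - g 0 1‖ ∧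
      ‖g 1 1‖ = ‖g 0 0‖ := by
  rw [hg.1, hg.2.1]
  refine ⟨?_, ?_, Complex.norm_conj _⟩
  · rw [← map_add, Complex.norm_conj, add_comm]
  · rw [← map_neg, ← map_add, Complex.norm_conj, neg_add_eq_sub]

lemma IsSU11.norm_moeb_sub {g : Matrix (Fin 2) (Fin 2) ℂ} (hg : IsSU11 g) {x y : ℂ}
    (hx : g 1 0 * x + g 1 1 ≠ 0) (hy : g 1 0 * y + g 1 1 ≠ 0) :
    ‖moeb g x - moeb g y‖ =
      ‖x - y‖ / (‖g 1 0 * x + g 1 1‖ * ‖g 1 0 * y + g 1 1‖) := by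
  have d : g 0 0 * g 1 1 - g 0 1 * g 1 0 = 1 := by
    rw [hg.1, hg.2.1]
    exact hg.mul_conj_sub
  rw [moeb, moeb, div_sub_div _ _ hx hy, norm_div, norm_mul]
  congr 2
  linear_combination (x - y) * d

lemma IsSU11.norm_moeb_zero_sub_one {g : Matrix (Fin 2) (Fin 2) ℂ} (hg : IsSU11 g) :
    ‖moeb g 0 - moeb g 1‖ = 1 / (‖g 0 0‖ * ‖g 0 0 + g 0 1‖) := by
  obtain ⟨h₁, -, h₀⟩ := hg.norm_sub_pos
  obtain ⟨e₁, -, e₀⟩ := hg.norm_denom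
  rw [hg.norm_moeb_sub]
  · simp [e₁, e₀]
  · simpa using norm_pos_iff.1 (e₀ ▸ h₀)
  · simpa using norm_pos_iff.1 (e₁ ▸ h₁)

lemma IsSU11.norm_moeb_zero_sub_neg_one {g : Matrix (Fin 2) (Fin 2) ℂ} (hg : IsSU11 g) :
    ‖moeb g 0 - moeb g (-1)‖ = 1 / (‖g 0 0‖ * ‖g 0 0 - g 0 1‖) := by
  obtain ⟨-, h₁, h₀⟩ := hg.norm_sub_pos
  obtain ⟨-, e₁, e₀⟩ := hg.norm_denom
  rw [hg.norm_moeb_sub]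
  · simp [e₁, e₀]
  · simpa using norm_pos_iff.1 (e₀ ▸ h₀)
  · simpa using norm_pos_iff.1 (e₁ ▸ h₁)

lemma IsSU11.norm_moeb_one_sub_neg_one {g : Matrix (Fin 2) (Fin 2) ℂ} (hg : IsSU11 g) :
    ‖moeb g 1 - moeb g (-1)‖ = 2 / (‖g 0 0 + g 0 1‖ * ‖g 0 0 - g 0 1‖) := by
  obtain ⟨h₁, h₂, -⟩ := hg.norm_sub_pos
  obtain ⟨e₁, e₂, -⟩ := hg.norm_denom
  rw [hg.norm_moeb_sub]
  · norm_num [e₁, e₂]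
  · simpa using norm_pos_iff.1 (e₁ ▸ h₁)
  · simpa using norm_pos_iff.1 (e₂ ▸ h₂)

/-- The Poisson kernel at `(g · 0, g · 1)`. -/
lemma IsSU11.Pk_moeb {g : Matrix (Fin 2) (Fin 2) ℂ} (hg : IsSU11 g) :
    Pk (moeb g 0) (moeb g 1) = ‖g 0 0 + g 0 1‖ ^ 2 := by
  obtain ⟨h₁, -, h₀⟩ := hg.norm_sub_pos
  have hz : ‖moeb g 0‖ = ‖g 0 1‖ / ‖g 0 0‖ := by
    simp [moeb, hg.norm_denom.2.2]
  rw [Pk, hg.norm_moeb_zero_sub_one, hz]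
  field_simp
  exact hg.2.2

lemma moeb_mul_Amat_mul_Nmat_one (g : Matrix (Fin 2) (Fin 2) ℂ) (τ u : ℝ) :
    moeb (g * Amat τ * Nmat u) 1 = moeb g 1 := by
  simp only [moeb, mul_one]
  rw [mul_Amat_mul_Nmat_row_sum, mul_Amat_mul_Nmat_row_sum]
  exact mul_div_mul_left _ _ (Complex.ofReal_ne_zero.2 (Real.exp_pos _).ne')

/-- For an oriented-geodesic frame `g₀` for `(b', b)` one has
`log(|b−b'|/2) + ⟨(g₀ A_τ N_u)·0, b⟩ = τ`, i.e.
`P((g₀ A_τ N_u)·0, b) = (2/|b−b'|) e^τ`. -/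
theorem busemann_along_flow (b b' : ℂ) (hb : ‖b‖ = 1) (hb' : ‖b'‖ = 1) (hne : b ≠ b')
    (g₀ : Matrix (Fin 2) (Fin 2) ℂ) (hg₀ : frameFor g₀ b' b) (τ u : ℝ) :
    Real.log (‖b - b'‖ / 2) + Real.log (Pk (moeb (g₀ * Amat τ * Nmat u) 0) b) = τ ∧
    Pk (moeb (g₀ * Amat τ * Nmat u) 0) b = (2 / ‖b - b'‖) * Real.exp τ := by
  obtain ⟨hg, rfl, rfl, heq⟩ := hg₀
  obtain ⟨h₁, h₂, h₀⟩ := hg.norm_sub_pos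
  rw [hg.norm_moeb_zero_sub_one, hg.norm_moeb_zero_sub_neg_one] at heq
  have hnorm : ‖g₀ 0 0 - g₀ 0 1‖ = ‖g₀ 0 0 + g₀ 0 1‖ := by
    field_simp at heq
    exact heq
  have hP : Pk (moeb (g₀ * Amat τ * Nmat u) 0) (moeb g₀ 1) =
      (2 / ‖moeb g₀ 1 - moeb g₀ (-1)‖) * Real.exp τ := by
    rw [← moeb_mul_Amat_mul_Nmat_one g₀ τ u,
      ((hg.mul (isSU11_Amat τ)).mul (isSU11_Nmat u)).Pk_moeb, mul_Amat_mul_Nmat_row_sum,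
      moeb_mul_Amat_mul_Nmat_one, hg.norm_moeb_one_sub_neg_one, hnorm, norm_mul,
      Complex.norm_real, Real.norm_of_nonneg (Real.exp_pos _).le, mul_pow, ← Real.exp_nat_mul]
    push_cast
    rw [mul_div_cancel₀ τ two_ne_zero]
    field_simp
  refine ⟨?_, hP⟩
  have hd : 0 < ‖moeb g₀ 1 - moeb g₀ (-1)‖ := norm_pos_iff.2 (sub_ne_zero.2 hne)
  rw [hP, ← Real.log_mul (by positivity) (by positivity), ← mul_assoc,
    div_mul_div_cancel₀ two_ne_zero, div_self hd.ne', one_mul, Real.log_exp]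
end
end

section
/- (Two-point boundary identity.) Let α, β ∈ ℂ with |α|² − |β|² = 1 and let g·w = (αw + β)/(conj(β)w + conj(α)) be the associated Möbius transformation. Then for all ζ₁, ζ₂ ∈ ℂ with |ζ₁| = |ζ₂| = 1: |g·ζ₁ − g·ζ₂|² · P(g·0, g·ζ₁) · P(g·0, g·ζ₂) = |ζ₁ − ζ₂|². -/
open Complex

noncomputable section

theorem mul_conj_sub_mul_conj_eq_one {α β : ℂ} (h : ‖α‖ ^ 2 - ‖β‖ ^ 2 = 1) :
    α * (starRingEnd ℂ) α - β * (starRingEnd ℂ) β = 1 := by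
  rw [Complex.mul_conj', Complex.mul_conj']
  exact_mod_cast h

theorem moebius_denom_ne_zero {α β ζ : ℂ} (h : ‖α‖ ^ 2 - ‖β‖ ^ 2 = 1) (hζ : ‖ζ‖ ≤ 1) :
    (starRingEnd ℂ) β * ζ + (starRingEnd ℂ) α ≠ 0 := by
  intro h0
  have hn : ‖α‖ = ‖β‖ * ‖ζ‖ := by
    simpa using congrArg norm (eq_neg_of_add_eq_zero_right h0)
  have hle : ‖α‖ ≤ ‖β‖ := hn.trans_le (mul_le_of_le_one_right (norm_nonneg β) hζ)
  nlinarith [norm_nonneg α]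

/-- The difference of two values of a Möbius transformation in `SU(1,1)`. -/
theorem moebius_sub_moebius {α β z w : ℂ} (h : ‖α‖ ^ 2 - ‖β‖ ^ 2 = 1)
    (hz : ‖z‖ ≤ 1) (hw : ‖w‖ ≤ 1) :
    (α * z + β) / ((starRingEnd ℂ) β * z + (starRingEnd ℂ) α) -
        (α * w + β) / ((starRingEnd ℂ) β * w + (starRingEnd ℂ) α) =
      (z - w) / (((starRingEnd ℂ) β * z + (starRingEnd ℂ) α) *
        ((starRingEnd ℂ) β * w + (starRingEnd ℂ) α)) := by
  rw [div_sub_div _ _ (moebius_denom_ne_zero h hz) (moebius_denom_ne_zero h hw)]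
  congr 1
  linear_combination (z - w) * mul_conj_sub_mul_conj_eq_one h

/-- The Poisson kernel at `(g·0, g·ζ)` is the squared modulus of the denominator of `g·ζ`. -/
theorem Pk_moebius_zero {α β ζ : ℂ} (h : ‖α‖ ^ 2 - ‖β‖ ^ 2 = 1) (hζ : ‖ζ‖ = 1) :
    Pk ((α * 0 + β) / ((starRingEnd ℂ) β * 0 + (starRingEnd ℂ) α))
        ((α * ζ + β) / ((starRingEnd ℂ) β * ζ + (starRingEnd ℂ) α)) =
      ‖(starRingEnd ℂ) β * ζ + (starRingEnd ℂ) α‖ ^ 2 := by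
  have hD := norm_ne_zero_iff.mpr (moebius_denom_ne_zero h hζ.le)
  have hα : ‖α‖ ≠ 0 := fun h0 => by nlinarith [sq_nonneg ‖β‖]
  rw [Pk, moebius_sub_moebius h (by simp) hζ.le]
  simp only [mul_zero, zero_add, zero_sub, norm_div, norm_mul, norm_neg, RCLike.norm_conj, hζ]
  field_simp
  linear_combination h

/-- Two-point boundary identity:
`|g·ζ₁ − g·ζ₂|² · P(g·0, g·ζ₁) · P(g·0, g·ζ₂) = |ζ₁ − ζ₂|²` for `g ∈ SU(1,1)`. -/
theorem two_point_boundary_identity (α β : ℂ) (h : ‖α‖ ^ 2 - ‖β‖ ^ 2 = 1)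
    (ζ₁ ζ₂ : ℂ) (h1 : ‖ζ₁‖ = 1) (h2 : ‖ζ₂‖ = 1) :
    ‖(α * ζ₁ + β) / ((starRingEnd ℂ) β * ζ₁ + (starRingEnd ℂ) α) -
        (α * ζ₂ + β) / ((starRingEnd ℂ) β * ζ₂ + (starRingEnd ℂ) α)‖ ^ 2 *
      Pk ((α * 0 + β) / ((starRingEnd ℂ) β * 0 + (starRingEnd ℂ) α))
        ((α * ζ₁ + β) / ((starRingEnd ℂ) β * ζ₁ + (starRingEnd ℂ) α)) *
      Pk ((α * 0 + β) / ((starRingEnd ℂ) β * 0 + (starRingEnd ℂ) α))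
        ((α * ζ₂ + β) / ((starRingEnd ℂ) β * ζ₂ + (starRingEnd ℂ) α)) =
    ‖ζ₁ - ζ₂‖ ^ 2 := by
  have hD₁ := norm_ne_zero_iff.mpr (moebius_denom_ne_zero h h1.le)
  have hD₂ := norm_ne_zero_iff.mpr (moebius_denom_ne_zero h h2.le)
  rw [Pk_moebius_zero h h1, Pk_moebius_zero h h2, moebius_sub_moebius h h1.le h2.le, norm_div,
    norm_mul, mul_assoc, ← mul_pow, ← mul_pow, div_mul_cancel₀ _ (mul_ne_zero hD₁ hD₂)]
end
end

section
/- (Möbius invariance of the measure db db'/|b−b'|² on pairs of boundary points.) Let α, β ∈ ℂ with |α|² − |β|² = 1 and let g·w = (αw + β)/(conj(β)w + conj(α)) be the associated Möbius transformation. Then for every measurable function f : ℂ × ℂ → [0, ∞]: ∫_{S¹} ∫_{S¹} f(g·b, g·b') / |b − b'|² db db' = ∫_{S¹} ∫_{S¹} f(b, b') / |b − b'|² db db', where db, db' denote the normalized (probability) arclength measure on S¹ and the integrands are interpreted in [0, ∞] (the diagonal b = b' has measure zero). -/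
open Complex MeasureTheory Real

noncomputable section

/-- Möbius transformation attached to `α β : ℂ` with `|α|² − |β|² = 1`. -/
def moebAB (α β : ℂ) (w : ℂ) : ℂ :=
  (α * w + β) / ((starRingEnd ℂ) β * w + (starRingEnd ℂ) α)

theorem lintegral_circleMeasure {F : ℂ → ENNReal} (hF : Measurable F) :
    ∫⁻ b, F b ∂circleMeasure = (ENNReal.ofReal (2 * Real.pi))⁻¹ *
      ∫⁻ θ in Set.Ioc (0 : ℝ) (2 * Real.pi), F (Complex.exp ((θ : ℂ) * Complex.I)) := by
  rw [circleMeasure, lintegral_smul_measure, lintegral_map hF (by fun_prop), smul_eq_mul]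

theorem ae_norm_eq_one_circleMeasure : ∀ᵐ b ∂circleMeasure, ‖b‖ = 1 := by
  refine Measure.ae_smul_measure ?_ _
  rw [ae_map_iff (by fun_prop) (measurableSet_eq_fun (by fun_prop) (by fun_prop))]
  exact Filter.Eventually.of_forall fun θ => Complex.norm_exp_ofReal_mul_I θ

theorem measurable_moebAB (α β : ℂ) : Measurable (moebAB α β) := by
  unfold moebAB
  fun_prop

/-- The derivative `|conj(β) b + conj(α)|⁻²` of the Möbius transformation along the circle. -/
def moebJacobian (α β b : ℂ) : ENNReal :=
  ENNReal.ofReal ((‖(starRingEnd ℂ) β * b + (starRingEnd ℂ) α‖ ^ 2)⁻¹)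

theorem measurable_moebJacobian (α β : ℂ) : Measurable (moebJacobian α β) := by
  unfold moebJacobian
  fun_prop

theorem norm_lt_norm_of_sq_sub_sq_eq_one {α β : ℂ} (h : ‖α‖ ^ 2 - ‖β‖ ^ 2 = 1) : ‖β‖ < ‖α‖ := by
  nlinarith [norm_nonneg α, norm_nonneg β]

theorem moebAB_denom_ne_zero {α β b : ℂ} (h : ‖α‖ ^ 2 - ‖β‖ ^ 2 = 1) (hb : ‖b‖ = 1) :
    (starRingEnd ℂ) β * b + (starRingEnd ℂ) α ≠ 0 := by
  intro h0
  have h1 : ‖(starRingEnd ℂ) β * b‖ = ‖(starRingEnd ℂ) α‖ := by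
    rw [eq_neg_of_add_eq_zero_left h0, norm_neg]
  rw [norm_mul, hb, mul_one, RCLike.norm_conj, RCLike.norm_conj] at h1
  exact (norm_lt_norm_of_sq_sub_sq_eq_one h).ne h1

/-- A lift to `ℝ` of the Möbius transformation of the unit circle. -/
def moebLift (α β : ℂ) (θ : ℝ) : ℝ :=
  θ + 2 * α.arg + 2 * (Complex.log (1 + β / α * Complex.exp (-((θ : ℂ) * Complex.I)))).im

theorem moebLift_add_two_pi (α β : ℂ) (θ : ℝ) :
    moebLift α β (θ + 2 * Real.pi) = moebLift α β θ + 2 * Real.pi := by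
  have : Complex.exp (-(((θ + 2 * Real.pi : ℝ) : ℂ) * Complex.I)) =
      Complex.exp (-((θ : ℂ) * Complex.I)) := by
    rw [Complex.exp_eq_exp_iff_exists_int]
    exact ⟨-1, by push_cast; ring⟩
  rw [moebLift, moebLift, this]
  ring

theorem norm_moebLift_param_lt_one {α β : ℂ} (h : ‖α‖ ^ 2 - ‖β‖ ^ 2 = 1) (θ : ℝ) :
    ‖β / α * Complex.exp (-((θ : ℂ) * Complex.I))‖ < 1 := by
  have hlt := norm_lt_norm_of_sq_sub_sq_eq_one h
  have he : ‖Complex.exp (-((θ : ℂ) * Complex.I))‖ = 1 := by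
    simpa using Complex.norm_exp_ofReal_mul_I (-θ)
  rw [norm_mul, he, mul_one, norm_div, div_lt_one ((norm_nonneg β).trans_lt hlt)]
  exact hlt

theorem exp_two_mul_arg_mul_I {z : ℂ} (hz : z ≠ 0) :
    Complex.exp (2 * (z.arg : ℂ) * Complex.I) = z / (starRingEnd ℂ) z := by
  have hz' : (starRingEnd ℂ) z ≠ 0 := by simpa using hz
  have hn : (‖z‖ : ℂ) ≠ 0 := by simpa using hz
  have h1 := Complex.norm_mul_exp_arg_mul_I z
  have h2 : z * (starRingEnd ℂ) z = (‖z‖ : ℂ) ^ 2 := Complex.mul_conj' z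
  have h3 : Complex.exp (2 * (z.arg : ℂ) * Complex.I) = Complex.exp (z.arg * Complex.I) ^ 2 := by
    rw [← Complex.exp_nat_mul]
    congr 1
    push_cast
    ring
  rw [h3, eq_div_iff hz']
  apply mul_left_cancel₀ (pow_ne_zero 2 hn)
  calc (‖z‖ : ℂ) ^ 2 * (Complex.exp (z.arg * Complex.I) ^ 2 * (starRingEnd ℂ) z)
      = (‖z‖ * Complex.exp (z.arg * Complex.I)) ^ 2 * (starRingEnd ℂ) z := by ring
    _ = z ^ 2 * (starRingEnd ℂ) z := by rw [h1]
    _ = (z * (starRingEnd ℂ) z) * z := by ring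
    _ = (‖z‖ : ℂ) ^ 2 * z := by rw [h2]

theorem exp_moebLift {α β : ℂ} (h : ‖α‖ ^ 2 - ‖β‖ ^ 2 = 1) (θ : ℝ) :
    Complex.exp ((moebLift α β θ : ℂ) * Complex.I) =
      moebAB α β (Complex.exp ((θ : ℂ) * Complex.I)) := by
  have hα : α ≠ 0 := norm_pos_iff.1 ((norm_nonneg β).trans_lt (norm_lt_norm_of_sq_sub_sq_eq_one h))
  have hα' : (starRingEnd ℂ) α ≠ 0 := by simpa using hα
  have hu := Complex.slitPlane_ne_zero
    (Complex.mem_slitPlane_of_norm_lt_one (norm_moebLift_param_lt_one h θ))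
  have hd := moebAB_denom_ne_zero h (Complex.norm_exp_ofReal_mul_I θ)
  have hsplit : (moebLift α β θ : ℂ) * Complex.I = (θ : ℂ) * Complex.I +
      2 * (α.arg : ℂ) * Complex.I +
      2 * ((1 + β / α * Complex.exp (-((θ : ℂ) * Complex.I))).arg : ℂ) * Complex.I := by
    rw [moebLift, Complex.log_im]
    push_cast
    ring
  have hconj : (starRingEnd ℂ) (Complex.exp (-((θ : ℂ) * Complex.I))) =
      Complex.exp ((θ : ℂ) * Complex.I) := by
    rw [← Complex.exp_conj]
    simp
  rw [hsplit, Complex.exp_add, Complex.exp_add, exp_two_mul_arg_mul_I hα, exp_two_mul_arg_mul_I hu,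
    moebAB, map_add, map_mul, map_div₀, hconj, map_one, Complex.exp_neg]
  have he := Complex.exp_ne_zero ((θ : ℂ) * Complex.I)
  have hd2 : 1 + (starRingEnd ℂ) β / (starRingEnd ℂ) α * Complex.exp ((θ : ℂ) * Complex.I) =
      ((starRingEnd ℂ) β * Complex.exp ((θ : ℂ) * Complex.I) + (starRingEnd ℂ) α) /
        (starRingEnd ℂ) α := by
    field_simp
    ring
  rw [hd2]
  generalize (starRingEnd ℂ) β * Complex.exp ((θ : ℂ) * Complex.I) + (starRingEnd ℂ) α = d at hd ⊢
  rw [eq_div_iff hd]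
  field_simp

theorem hasDerivAt_moebLift {α β : ℂ} (h : ‖α‖ ^ 2 - ‖β‖ ^ 2 = 1) (θ : ℝ) :
    HasDerivAt (moebLift α β)
      ((‖(starRingEnd ℂ) β * Complex.exp ((θ : ℂ) * Complex.I) + (starRingEnd ℂ) α‖ ^ 2)⁻¹) θ := by
  have hα : α ≠ 0 := norm_pos_iff.1 ((norm_nonneg β).trans_lt (norm_lt_norm_of_sq_sub_sq_eq_one h))
  set z : ℂ := β / α * Complex.exp (-((θ : ℂ) * Complex.I)) with hz
  have hzlt : ‖z‖ < 1 := norm_moebLift_param_lt_one h θ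
  have hs : 1 + z ∈ Complex.slitPlane := Complex.mem_slitPlane_of_norm_lt_one hzlt
  have hu := Complex.slitPlane_ne_zero hs
  have hθ : HasDerivAt (fun t : ℝ => -((t : ℂ) * Complex.I)) (-(1 * Complex.I)) θ :=
    ((Complex.ofRealCLM.hasDerivAt (x := θ)).mul_const Complex.I).neg
  have hinner : HasDerivAt (fun t : ℝ => 1 + β / α * Complex.exp (-((t : ℂ) * Complex.I)))
      (-Complex.I * z) θ := by
    refine ((hθ.cexp.const_mul (β / α)).const_add 1).congr_deriv ?_
    rw [hz]
    ring
  have him := Complex.imCLM.hasFDerivAt.comp_hasDerivAt θ (hinner.clog_real hs)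
  rw [← hz] at him
  refine (((hasDerivAt_id θ).add_const (2 * α.arg)).add (him.const_mul 2)).congr_deriv ?_
  have hnorm : ‖(starRingEnd ℂ) β * Complex.exp ((θ : ℂ) * Complex.I) + (starRingEnd ℂ) α‖ =
      ‖α‖ * ‖1 + z‖ := by
    rw [← RCLike.norm_conj, ← norm_mul]
    congr 1
    simp only [map_add, map_mul, Complex.conj_conj, ← Complex.exp_conj, Complex.conj_ofReal,
      Complex.conj_I, hz, mul_neg]
    field_simp
    ring
  have hez : ‖z‖ = ‖β‖ / ‖α‖ := by
    have he : ‖Complex.exp (-((θ : ℂ) * Complex.I))‖ = 1 := by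
      simpa using Complex.norm_exp_ofReal_mul_I (-θ)
    rw [hz, norm_mul, he, mul_one, norm_div]
  have hαp : 0 < ‖α‖ := norm_pos_iff.2 hα
  have hz2 : ‖α‖ ^ 2 * (1 - ‖z‖ ^ 2) = 1 := by
    rw [hez]
    field_simp
    exact h
  rw [hnorm, Complex.imCLM_apply, Complex.div_im]
  have hns : Complex.normSq (1 + z) ≠ 0 := by simpa using hu
  rw [mul_pow, ← Complex.normSq_eq_norm_sq (1 + z)]
  rw [← Complex.normSq_eq_norm_sq z] at hz2
  have hα2 : ‖α‖ ^ 2 ≠ 0 := by positivity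
  rw [eq_comm, inv_eq_iff_eq_inv, eq_comm, inv_eq_iff_eq_inv, ← one_div, eq_div_iff (by positivity)]
  have e : Complex.normSq (1 + z) = (1 + z.re) ^ 2 + z.im ^ 2 := by
    rw [Complex.normSq_apply]
    simp
    ring
  have e2 : Complex.normSq z = z.re ^ 2 + z.im ^ 2 := by
    rw [Complex.normSq_apply]
    ring
  rw [e2] at hz2
  simp only [Complex.add_re, Complex.one_re, Complex.add_im, Complex.one_im, Complex.mul_re,
    Complex.mul_im, Complex.neg_re, Complex.neg_im, Complex.I_re, Complex.I_im]
  field_simp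
  rw [e]
  linear_combination hz2

theorem strictMono_moebLift {α β : ℂ} (h : ‖α‖ ^ 2 - ‖β‖ ^ 2 = 1) : StrictMono (moebLift α β) := by
  refine strictMono_of_hasDerivAt_pos (hasDerivAt_moebLift h) fun θ => ?_
  have := norm_pos_iff.2 (moebAB_denom_ne_zero h (Complex.norm_exp_ofReal_mul_I θ))
  positivity

theorem moebLift_image_Ioc {α β : ℂ} (h : ‖α‖ ^ 2 - ‖β‖ ^ 2 = 1) :
    moebLift α β '' Set.Ioc 0 (2 * Real.pi) =
      Set.Ioc (moebLift α β 0) (moebLift α β 0 + 2 * Real.pi) := by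
  have hend : moebLift α β (2 * Real.pi) = moebLift α β 0 + 2 * Real.pi := by
    simpa using moebLift_add_two_pi α β 0
  have hmono := strictMono_moebLift h
  rw [← hend]
  apply Set.Subset.antisymm
  · rintro _ ⟨t, ht, rfl⟩
    exact ⟨hmono ht.1, hmono.monotone ht.2⟩
  · exact intermediate_value_Ioc Real.two_pi_pos.le
      fun t _ => (hasDerivAt_moebLift h t).continuousAt.continuousWithinAt

theorem Function.Periodic.setLIntegral_Ioc_add_eq {G : ℝ → ENNReal} {T : ℝ}
    (hG : Function.Periodic G T) (hT : 0 < T) (s t : ℝ) :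
    ∫⁻ x in Set.Ioc s (s + T), G x = ∫⁻ x in Set.Ioc t (t + T), G x := by
  refine (isAddFundamentalDomain_Ioc hT s).setLIntegral_eq (isAddFundamentalDomain_Ioc hT t) G ?_
  rintro ⟨g, hg⟩ x
  obtain ⟨n, rfl⟩ := AddSubgroup.mem_zmultiples_iff.1 hg
  rw [AddSubgroup.mk_vadd, vadd_eq_add, add_comm]
  exact hG.zsmul n x

theorem lintegral_moebAB_mul_moebJacobian {α β : ℂ} (h : ‖α‖ ^ 2 - ‖β‖ ^ 2 = 1)
    {F : ℂ → ENNReal} (hF : Measurable F) :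
    ∫⁻ b, moebJacobian α β b * F (moebAB α β b) ∂circleMeasure = ∫⁻ b, F b ∂circleMeasure := by
  have hm : Measurable fun b => moebJacobian α β b * F (moebAB α β b) :=
    (measurable_moebJacobian α β).mul (hF.comp (measurable_moebAB α β))
  rw [lintegral_circleMeasure hF, lintegral_circleMeasure hm]
  congr 1
  have hper : Function.Periodic (fun θ : ℝ => F (Complex.exp ((θ : ℂ) * Complex.I)))
      (2 * Real.pi) := by
    intro θ
    refine congrArg F ?_
    rw [Complex.exp_eq_exp_iff_exists_int]
    exact ⟨1, by push_cast; ring⟩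
  have hshift := hper.setLIntegral_Ioc_add_eq Real.two_pi_pos (moebLift α β 0) 0
  rw [zero_add, ← moebLift_image_Ioc h, lintegral_image_eq_lintegral_abs_deriv_mul measurableSet_Ioc
    (fun θ _ => (hasDerivAt_moebLift h θ).hasDerivWithinAt)
    (strictMono_moebLift h).injective.injOn] at hshift
  rw [← hshift]
  refine lintegral_congr fun θ => ?_
  rw [exp_moebLift h, abs_of_nonneg (by positivity), moebJacobian]

theorem norm_moebAB_sub_sq {α β b b' : ℂ} (h : ‖α‖ ^ 2 - ‖β‖ ^ 2 = 1)
    (hb : ‖b‖ = 1) (hb' : ‖b'‖ = 1) :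
    ENNReal.ofReal (‖moebAB α β b - moebAB α β b'‖ ^ 2) =
      moebJacobian α β b * moebJacobian α β b' * ENNReal.ofReal (‖b - b'‖ ^ 2) := by
  have hd := moebAB_denom_ne_zero h hb
  have hd' := moebAB_denom_ne_zero h hb'
  have hdet : α * (starRingEnd ℂ) α - β * (starRingEnd ℂ) β = 1 := by
    rw [Complex.mul_conj', Complex.mul_conj']
    exact_mod_cast h
  have hsub : moebAB α β b - moebAB α β b' =
      (b - b') / (((starRingEnd ℂ) β * b + (starRingEnd ℂ) α) *
        ((starRingEnd ℂ) β * b' + (starRingEnd ℂ) α)) := by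
    rw [moebAB, moebAB, div_sub_div _ _ hd hd']
    congr 1
    linear_combination (b - b') * hdet
  rw [moebJacobian, moebJacobian, ← ENNReal.ofReal_mul (by positivity),
    ← ENNReal.ofReal_mul (by positivity), hsub, norm_div, norm_mul]
  congr 1
  rw [div_pow, mul_pow, div_eq_mul_inv, mul_inv]
  ring

theorem div_norm_sub_sq_eq_moebJacobian_mul {α β b b' : ℂ} (h : ‖α‖ ^ 2 - ‖β‖ ^ 2 = 1)
    (hb : ‖b‖ = 1) (hb' : ‖b'‖ = 1) (c : ENNReal) :
    c / ENNReal.ofReal (‖b - b'‖ ^ 2) = moebJacobian α β b * (moebJacobian α β b' *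
      (c / ENNReal.ofReal (‖moebAB α β b - moebAB α β b'‖ ^ 2))) := by
  have hJ : ∀ {w : ℂ}, ‖w‖ = 1 → moebJacobian α β w ≠ 0 := fun hw => by
    have := norm_pos_iff.2 (moebAB_denom_ne_zero h hw)
    exact (ENNReal.ofReal_pos.2 (by positivity)).ne'
  have hJ0 : moebJacobian α β b * moebJacobian α β b' ≠ 0 := mul_ne_zero (hJ hb) (hJ hb')
  have hJt : moebJacobian α β b * moebJacobian α β b' ≠ ⊤ :=
    ENNReal.mul_ne_top ENNReal.ofReal_ne_top ENNReal.ofReal_ne_top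
  rw [norm_moebAB_sub_sq h hb hb', ← mul_assoc, ← mul_div_assoc, ENNReal.mul_div_mul_left _ _ hJ0 hJt]

/-- Möbius invariance of the measure `db db'/|b−b'|²` on pairs of boundary points. -/
theorem moebius_invariance_boundary_pairs (α β : ℂ) (h : ‖α‖ ^ 2 - ‖β‖ ^ 2 = 1)
    (f : ℂ → ℂ → ENNReal) (hf : Measurable (fun p : ℂ × ℂ => f p.1 p.2)) :
    (∫⁻ b, ∫⁻ b',
        f (moebAB α β b) (moebAB α β b') / ENNReal.ofReal (‖b - b'‖ ^ 2)
          ∂circleMeasure ∂circleMeasure) =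
    ∫⁻ b, ∫⁻ b', f b b' / ENNReal.ofReal (‖b - b'‖ ^ 2)
      ∂circleMeasure ∂circleMeasure := by
  have hH : Measurable fun p : ℂ × ℂ => f p.1 p.2 / ENNReal.ofReal (‖p.1 - p.2‖ ^ 2) :=
    hf.div (by fun_prop)
  have : SFinite circleMeasure := by
    unfold circleMeasure
    infer_instance
  rw [← lintegral_moebAB_mul_moebJacobian h hH.lintegral_prod_right']
  refine lintegral_congr_ae ?_
  filter_upwards [ae_norm_eq_one_circleMeasure] with b hb
  have hHb : Measurable fun b' : ℂ =>
      f (moebAB α β b) b' / ENNReal.ofReal (‖moebAB α β b - b'‖ ^ 2) :=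
    hH.comp measurable_prodMk_left
  have hm : Measurable fun b' : ℂ => moebJacobian α β b' * (f (moebAB α β b) (moebAB α β b') /
      ENNReal.ofReal (‖moebAB α β b - moebAB α β b'‖ ^ 2)) :=
    (measurable_moebJacobian α β).mul (hHb.comp (measurable_moebAB α β))
  rw [← lintegral_moebAB_mul_moebJacobian h hHb, ← lintegral_const_mul _ hm]
  refine lintegral_congr_ae ?_
  filter_upwards [ae_norm_eq_one_circleMeasure] with b' hb'
  exact div_norm_sub_sq_eq_moebJacobian_mul h hb hb' _
end
end

section
/- For all u, τ ∈ ℝ, the point z = e^τ (u + i)/√(1+u²) of the hyperbolic upper half-plane ℍ satisfies exp(dist(z, i)) ≥ (1 + |u|) · e^{|τ|} / 4; in particular exp(dist(z, i)) ≥ C₁(1+|u|)e^{|τ|} − C₂ with C₁ = 1/4 and C₂ = 0. -/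
open Complex Real

noncomputable section

/-- The point `e^τ (u + i)/√(1+u²)` of the upper half-plane. -/
def hpt (u τ : ℝ) : ℂ :=
  (Real.exp τ : ℂ) * ((u : ℂ) + Complex.I) / (Real.sqrt (1 + u ^ 2) : ℂ)

theorem hpt_re (u τ : ℝ) : (hpt u τ).re = Real.exp τ * u / √(1 + u ^ 2) := by
  rw [hpt, Complex.div_ofReal_re, Complex.re_ofReal_mul]
  simp

theorem hpt_im (u τ : ℝ) : (hpt u τ).im = Real.exp τ / √(1 + u ^ 2) := by
  rw [hpt, Complex.div_ofReal_im, Complex.im_ofReal_mul]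
  simp

theorem cosh_dist_hpt_I (u τ : ℝ) (hz : 0 < (hpt u τ).im) :
    Real.cosh (dist (⟨hpt u τ, hz⟩ : UpperHalfPlane) UpperHalfPlane.I) =
      √(1 + u ^ 2) * Real.cosh τ := by
  have hs : √(1 + u ^ 2) ≠ 0 := by positivity
  have hsq : √(1 + u ^ 2) ^ 2 = 1 + u ^ 2 := Real.sq_sqrt (by positivity)
  have he : Real.exp τ ≠ 0 := (Real.exp_pos τ).ne'
  have hre : (⟨hpt u τ, hz⟩ : UpperHalfPlane).re = Real.exp τ * u / √(1 + u ^ 2) := hpt_re u τ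
  have him : (⟨hpt u τ, hz⟩ : UpperHalfPlane).im = Real.exp τ / √(1 + u ^ 2) := hpt_im u τ
  rw [UpperHalfPlane.cosh_dist', hre, him, UpperHalfPlane.I_re, UpperHalfPlane.I_im,
    Real.cosh_eq, Real.exp_neg]
  field_simp
  linear_combination -Real.exp τ ^ 2 * hsq

theorem one_add_abs_le_two_mul_sqrt (u : ℝ) : 1 + |u| ≤ 2 * √(1 + u ^ 2) := by
  have h_one : 1 ≤ √(1 + u ^ 2) := Real.one_le_sqrt.2 (by nlinarith [sq_nonneg u])
  have h_abs : |u| ≤ √(1 + u ^ 2) := Real.abs_le_sqrt (by linarith)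
  linarith

theorem exp_abs_le_two_mul_cosh (τ : ℝ) : Real.exp |τ| ≤ 2 * Real.cosh τ := by
  rw [← Real.cosh_abs, Real.cosh_eq]
  linarith [Real.exp_pos (-|τ|)]

theorem cosh_le_exp_of_nonneg {x : ℝ} (hx : 0 ≤ x) : Real.cosh x ≤ Real.exp x := by
  rw [← Real.cosh_add_sinh]
  linarith [Real.sinh_nonneg_iff.2 hx]

/-- The point `z = e^τ(u+i)/√(1+u²)` of the hyperbolic upper half-plane satisfies
`exp(dist(z, i)) ≥ (1 + |u|) e^{|τ|} / 4`; in particular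
`exp(dist(z,i)) ≥ C₁(1+|u|)e^{|τ|} − C₂` with `C₁ = 1/4`, `C₂ = 0`. -/
theorem exp_dist_flow_point_lower_bound (u τ : ℝ) :
    0 < (hpt u τ).im ∧
    ∀ hz : 0 < (hpt u τ).im,
      (1 + |u|) * Real.exp |τ| / 4 ≤
        Real.exp (dist (⟨hpt u τ, hz⟩ : UpperHalfPlane) UpperHalfPlane.I) ∧
      (1 / 4) * (1 + |u|) * Real.exp |τ| - 0 ≤
        Real.exp (dist (⟨hpt u τ, hz⟩ : UpperHalfPlane) UpperHalfPlane.I) := by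
  refine ⟨by rw [hpt_im]; positivity, fun hz => ?_⟩
  have key : (1 + |u|) * Real.exp |τ| / 4 ≤
      Real.exp (dist (⟨hpt u τ, hz⟩ : UpperHalfPlane) UpperHalfPlane.I) := by
    calc (1 + |u|) * Real.exp |τ| / 4
        ≤ (2 * √(1 + u ^ 2)) * (2 * Real.cosh τ) / 4 := by
          gcongr
          · exact one_add_abs_le_two_mul_sqrt u
          · exact exp_abs_le_two_mul_cosh τ
      _ = Real.cosh (dist (⟨hpt u τ, hz⟩ : UpperHalfPlane) UpperHalfPlane.I) := by
          rw [cosh_dist_hpt_I]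
          ring
      _ ≤ _ := cosh_le_exp_of_nonneg dist_nonneg
  exact ⟨key, by linarith⟩
end
end

section
/- (Summability of the double spectral sum under a two-dimensional Weyl law.) Let λ : ℕ → ℝ be a sequence with λ_j ≥ 0 for all j, and suppose there exist constants c > 0 and C > 0 such that for every x ≥ 0 the set {j ∈ ℕ : λ_j ≤ x} is finite and |card{j : λ_j ≤ x} − c·x| ≤ C(√x + 1). Then the double series ∑_{(j,k) ∈ ℕ×ℕ} (1 + λ_j²)^{−1} · (1 + (λ_j − λ_k)²)^{−1} converges (the family is summable). -/
open Real

/-- A nonnegative family dominated by a function of the index of a bin is summable as soon as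
the bin weights, multiplied by bounds for the bin sizes, are summable. -/
theorem summable_of_le_comp_of_card_fiber_le {ι κ : Type*} [DecidableEq κ] (b : ι → κ)
    {f : ι → ℝ} {w N : κ → ℝ} (hf : ∀ i, 0 ≤ f i) (hfw : ∀ i, f i ≤ w (b i))
    (hw : ∀ k, 0 ≤ w k) (hN : ∀ (s : Finset ι) k, ((s.filter (b · = k)).card : ℝ) ≤ N k)
    (hsum : Summable fun k => N k * w k) : Summable f := by
  have hN0 : ∀ k, 0 ≤ N k := fun k => by simpa using hN ∅ k
  refine summable_of_sum_le hf (c := ∑' k, N k * w k) fun s => ?_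
  calc ∑ i ∈ s, f i ≤ ∑ i ∈ s, w (b i) := Finset.sum_le_sum fun i _ => hfw i
    _ = ∑ k ∈ s.image b, ((s.filter (b · = k)).card : ℝ) * w k := by
        rw [Finset.sum_comp w b]; simp
    _ ≤ ∑ k ∈ s.image b, N k * w k :=
        Finset.sum_le_sum fun k _ => mul_le_mul_of_nonneg_right (hN s k) (hw k)
    _ ≤ ∑' k, N k * w k :=
        hsum.sum_le_tsum _ fun k _ => mul_nonneg (hN0 k) (hw k)

theorem summable_inv_sq_mul_inv_sq_abs_sub :
    Summable fun p : ℕ × ℕ =>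
      (((p.1 : ℝ) + 1) ^ 2)⁻¹ * ((|(p.1 : ℝ) - p.2| + 1) ^ 2)⁻¹ := by
  have h1 : Summable fun n : ℕ => (((n : ℝ) + 1) ^ 2)⁻¹ := by
    have := (summable_nat_add_iff 1).2 (Real.summable_nat_pow_inv.2 one_lt_two)
    simpa using this
  have h2 : Summable fun z : ℤ => ((|(z : ℝ)| + 1) ^ 2)⁻¹ := by
    refine Summable.of_nat_of_neg ?_ ?_ <;> simpa using h1
  have h3 := h1.mul_of_nonneg h2 (fun _ => by positivity) (fun _ => by positivity)
  have hinj : Function.Injective fun p : ℕ × ℕ => ((p.1, (p.1 : ℤ) - p.2) : ℕ × ℤ) := by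
    rintro ⟨a, b⟩ ⟨c, d⟩ h
    simp only [Prod.mk.injEq] at h ⊢
    omega
  simpa [Function.comp_def] using h3.comp_injective hinj

/-- Under a two-dimensional Weyl law, the number of eigenvalues whose square root lies in
`(m - 1, m]` is `O(m + 1)`. -/
theorem card_filter_ceil_sqrt_le (lam : ℕ → ℝ) (c C : ℝ) (hc : 0 < c) (hC : 0 < C)
    (hfin : ∀ x : ℝ, 0 ≤ x → {j : ℕ | lam j ≤ x}.Finite)
    (hweyl : ∀ x : ℝ, 0 ≤ x →
      |({j : ℕ | lam j ≤ x}.ncard : ℝ) - c * x| ≤ C * (Real.sqrt x + 1))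
    (s : Finset ℕ) (m : ℕ) :
    ((s.filter fun j => ⌈√(lam j)⌉₊ = m).card : ℝ) ≤ (2 * c + 2 * C) * (m + 1) := by
  have hupper : ∀ j, ⌈√(lam j)⌉₊ = m → lam j ≤ (m : ℝ) ^ 2 := fun j hj =>
    (Real.sqrt_le_left (by positivity)).1 (hj ▸ Nat.le_ceil _)
  have hm := abs_le.1 (hweyl ((m : ℝ) ^ 2) (by positivity))
  rw [Real.sqrt_sq (by positivity)] at hm
  rcases m with _ | m
  · have hle : (s.filter fun j => ⌈√(lam j)⌉₊ = 0).card ≤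
        {j : ℕ | lam j ≤ ((0 : ℕ) : ℝ) ^ 2}.ncard := by
      rw [← Set.ncard_coe_finset]
      refine Set.ncard_le_ncard (fun j hj => ?_) (hfin _ (by positivity))
      exact hupper j (by simpa using (Finset.mem_filter.1 hj).2)
    have : ((s.filter fun j => ⌈√(lam j)⌉₊ = 0).card : ℝ) ≤ _ := Nat.cast_le.2 hle
    push_cast at *
    linarith [hm.2]
  · have hm' := abs_le.1 (hweyl ((m : ℝ) ^ 2) (by positivity))
    rw [Real.sqrt_sq (by positivity)] at hm'
    have hdisj : Disjoint (↑(s.filter fun j => ⌈√(lam j)⌉₊ = m + 1) : Set ℕ)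
        {j : ℕ | lam j ≤ (m : ℝ) ^ 2} := by
      refine Set.disjoint_left.2 fun j hj hj' => ?_
      have h1 : √(lam j) ≤ m := (Real.sqrt_le_left (by positivity)).2 hj'
      have h2 := (Finset.mem_filter.1 hj).2
      have h3 := Nat.ceil_le.2 h1
      omega
    have hle : (s.filter fun j => ⌈√(lam j)⌉₊ = m + 1).card +
        {j : ℕ | lam j ≤ (m : ℝ) ^ 2}.ncard ≤
        {j : ℕ | lam j ≤ ((m + 1 : ℕ) : ℝ) ^ 2}.ncard := by
      rw [← Set.ncard_coe_finset,
        ← Set.ncard_union_eq hdisj (Finset.finite_toSet _) (hfin _ (by positivity))]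
      refine Set.ncard_le_ncard (Set.union_subset (fun j hj => ?_) fun j hj => ?_)
        (hfin _ (by positivity))
      · exact hupper j (Finset.mem_filter.1 hj).2
      · refine le_trans (Set.mem_ofPred.1 hj) ?_
        gcongr
        simp
    have := (Nat.cast_le (α := ℝ)).2 hle
    push_cast at *
    nlinarith [hm.2, hm'.1]

theorem inv_one_add_sq_sq_le {m : ℕ} {u : ℝ} (hu : (m : ℝ) - 1 ≤ u) :
    (1 + (u ^ 2) ^ 2)⁻¹ ≤ 81 * (((m : ℝ) + 1) ^ 4)⁻¹ := by
  rw [← div_eq_mul_inv, inv_le_comm₀ (by positivity) (by positivity), inv_div,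
    div_le_iff₀ (by norm_num)]
  rcases Nat.lt_or_ge m 2 with h | h
  · have h2 : (m : ℝ) ≤ 1 := by exact_mod_cast Nat.le_of_lt_succ h
    have : ((m : ℝ) + 1) ^ 4 ≤ (2 : ℝ) ^ 4 := by gcongr; linarith
    nlinarith [sq_nonneg (u ^ 2)]
  · have h2 : (2 : ℝ) ≤ m := by exact_mod_cast h
    have : ((m : ℝ) + 1) ^ 4 ≤ (3 * u) ^ 4 := by gcongr; linarith
    nlinarith

theorem sub_add_one_mul_add_one_le {a b u v : ℝ} (hb : 0 ≤ b) (hab : b + 2 ≤ a)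
    (hu : a - 1 ≤ u) (hv : v ≤ b) (hv0 : 0 ≤ v) :
    (a - b + 1) * (a + 1) ≤ 9 * (u ^ 2 - v ^ 2) := by
  have h1 : a - b + 1 ≤ 3 * (u - v) := by linarith
  have h2 : a + 1 ≤ 3 * (u + v) := by linarith
  have := mul_le_mul h1 h2 (by linarith) (by linarith)
  linarith

theorem inv_one_add_sq_sub_sq_le {m n : ℕ} {u v : ℝ} (hu0 : 0 ≤ u) (hv0 : 0 ≤ v)
    (hu : (m : ℝ) - 1 ≤ u) (hu' : u ≤ m) (hv : (n : ℝ) - 1 ≤ v) (hv' : v ≤ n) :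
    (1 + (u ^ 2 - v ^ 2) ^ 2)⁻¹ ≤
      81 * (((m : ℝ) + 1) * ((n + 1) * (|(m : ℝ) - n| + 1) ^ 2)⁻¹) := by
  have hm0 : (0 : ℝ) ≤ m := m.cast_nonneg
  have hn0 : (0 : ℝ) ≤ n := n.cast_nonneg
  have hfar : ((|(m : ℝ) - n| + 1) * (n + 1)) ≤ 9 * |u ^ 2 - v ^ 2| →
      (1 + (u ^ 2 - v ^ 2) ^ 2)⁻¹ ≤
      81 * (((m : ℝ) + 1) * ((n + 1) * (|(m : ℝ) - n| + 1) ^ 2)⁻¹) := by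
    intro h
    rw [← div_eq_mul_inv, ← mul_div_assoc, inv_eq_one_div,
      div_le_div_iff₀ (by positivity) (by positivity)]
    have h2 := pow_le_pow_left₀ (by positivity) h 2
    rw [mul_pow, mul_pow, sq_abs] at h2
    have h3 : ((n : ℝ) + 1) * (|(m : ℝ) - n| + 1) ^ 2 ≤
        (|(m : ℝ) - n| + 1) ^ 2 * ((n : ℝ) + 1) ^ 2 := by
      rw [mul_comm]
      gcongr
      nlinarith
    have h4 : (0 : ℝ) ≤ m * (1 + (u ^ 2 - v ^ 2) ^ 2) := by positivity
    nlinarith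
  rcases lt_or_ge (n + 1) m with h | h
  · have h' : (n : ℝ) + 2 ≤ m := by exact_mod_cast h
    apply hfar
    have := sub_add_one_mul_add_one_le hn0 h' hu hv' hv0
    rw [abs_of_nonneg (by linarith : (0 : ℝ) ≤ m - n)]
    have := le_abs_self (u ^ 2 - v ^ 2)
    nlinarith
  rcases lt_or_ge (m + 1) n with h₂ | h₂
  · have h' : (m : ℝ) + 2 ≤ n := by exact_mod_cast h₂
    apply hfar
    have := sub_add_one_mul_add_one_le hm0 h' hv hu' hu0
    rw [abs_of_nonpos (by linarith : (m : ℝ) - n ≤ 0)]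
    have := neg_le_abs (u ^ 2 - v ^ 2)
    nlinarith
  · have h' : (m : ℝ) ≤ n + 1 := by exact_mod_cast h
    have h₂' : (n : ℝ) ≤ m + 1 := by exact_mod_cast h₂
    have hD : |(m : ℝ) - n| ≤ 1 := abs_le.2 ⟨by linarith, by linarith⟩
    refine (inv_le_one_of_one_le₀ (by nlinarith)).trans ?_
    rw [← div_eq_mul_inv, ← mul_div_assoc, one_le_div (by positivity)]
    have : (|(m : ℝ) - n| + 1) ^ 2 ≤ (2 : ℝ) ^ 2 := by gcongr; linarith
    nlinarith

/-- Summability of the double spectral sum `∑ ⟨λ_j⟩⁻² ⟨λ_j − λ_k⟩⁻²` under a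
two-dimensional Weyl law for the sequence of eigenvalues. -/
theorem summable_double_spectral_sum (lam : ℕ → ℝ) (hpos : ∀ j, 0 ≤ lam j)
    (c C : ℝ) (hc : 0 < c) (hC : 0 < C)
    (hfin : ∀ x : ℝ, 0 ≤ x → {j : ℕ | lam j ≤ x}.Finite)
    (hweyl : ∀ x : ℝ, 0 ≤ x →
      |({j : ℕ | lam j ≤ x}.ncard : ℝ) - c * x| ≤ C * (Real.sqrt x + 1)) :
    Summable (fun p : ℕ × ℕ =>
      (1 + lam p.1 ^ 2)⁻¹ * (1 + (lam p.1 - lam p.2) ^ 2)⁻¹) := by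
  have hlow : ∀ j, (⌈√(lam j)⌉₊ : ℝ) - 1 ≤ √(lam j) := fun j => by
    linarith [Nat.ceil_lt_add_one (Real.sqrt_nonneg (lam j))]
  refine summable_of_le_comp_of_card_fiber_le
    (fun p : ℕ × ℕ => (⌈√(lam p.1)⌉₊, ⌈√(lam p.2)⌉₊))
    (w := fun q => 81 * (((q.1 : ℝ) + 1) ^ 4)⁻¹ *
      (81 * (((q.1 : ℝ) + 1) * ((q.2 + 1) * (|(q.1 : ℝ) - q.2| + 1) ^ 2)⁻¹)))
    (N := fun q => ((2 * c + 2 * C) * (q.1 + 1)) * ((2 * c + 2 * C) * (q.2 + 1)))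
    (fun p => by positivity) (fun p => ?_) (fun q => by positivity) (fun s q => ?_) ?_
  · have h1 := inv_one_add_sq_sq_le (hlow p.1)
    have h2 := inv_one_add_sq_sub_sq_le (Real.sqrt_nonneg _) (Real.sqrt_nonneg _)
      (hlow p.1) (Nat.le_ceil _) (hlow p.2) (Nat.le_ceil _)
    rw [Real.sq_sqrt (hpos _)] at h1 h2
    rw [Real.sq_sqrt (hpos _)] at h2
    exact mul_le_mul h1 h2 (by positivity) (by positivity)
  · have hsub : s.filter (fun p => (⌈√(lam p.1)⌉₊, ⌈√(lam p.2)⌉₊) = q) ⊆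
        ((s.image Prod.fst).filter fun j => ⌈√(lam j)⌉₊ = q.1) ×ˢ
          ((s.image Prod.snd).filter fun j => ⌈√(lam j)⌉₊ = q.2) := by
      intro p hp
      obtain ⟨hps, rfl⟩ := Finset.mem_filter.1 hp
      simp only [Finset.mem_product, Finset.mem_filter, and_true]
      exact ⟨Finset.mem_image_of_mem _ hps, Finset.mem_image_of_mem _ hps⟩
    have hcard := (Nat.cast_le (α := ℝ)).2 (Finset.card_le_card hsub)
    rw [Finset.card_product, Nat.cast_mul] at hcard
    refine hcard.trans (mul_le_mul ?_ ?_ (by positivity) (by positivity)) <;>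
      exact card_filter_ceil_sqrt_le lam c C hc hC hfin hweyl _ _
  · refine (summable_inv_sq_mul_inv_sq_abs_sub.mul_left
      (6561 * (2 * c + 2 * C) ^ 2)).congr fun q => ?_
    field_simp
    ring
end

section
/- (Convergence of the double series controlling the Patterson–Sullivan pairings.) Let c, C > 0 and let r : ℕ → ℝ satisfy c·√(j+1) ≤ r_j ≤ C·√(j+1) for all j ∈ ℕ (the growth of the spectral parameters given by Weyl's law in dimension two). Then for all real M > 1 and N > 11, the double series ∑_{(j,k) ∈ ℕ×ℕ} (1 + |r_j − r_k|)^{−M} · r_j³ · r_k³ · max(r_j, r_k) · (1 + (r_j + r_k)/2)^{−N} converges (the family is summable). -/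
open Real

/-- The summand is controlled by the arithmetic mean of the two parameters: the decay in
the difference is only used through its boundedness by `1`. -/
lemma PS_term_le {x y M N : ℝ} (hx : 0 < x) (hy : 0 < y) (hM : 0 ≤ M) :
    (1 + |x - y|) ^ (-M) * x ^ 3 * y ^ 3 * max x y * (1 + (x + y) / 2) ^ (-N) ≤
      2 ^ 7 * (1 + (x + y) / 2) ^ (7 - N) := by
  set S := 1 + (x + y) / 2 with hS
  have hS0 : 0 < S := by positivity
  have hxS : x ≤ 2 * S := by linarith
  have hyS : y ≤ 2 * S := by linarith
  have h1 : (1 + |x - y|) ^ (-M) ≤ 1 :=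
    rpow_le_one_of_one_le_of_nonpos (by linarith [abs_nonneg (x - y)]) (by linarith)
  have hm : max x y ≤ 2 * S := max_le hxS hyS
  have hm0 : 0 ≤ max x y := hx.le.trans (le_max_left _ _)
  calc (1 + |x - y|) ^ (-M) * x ^ 3 * y ^ 3 * max x y * S ^ (-N)
      ≤ 1 * (2 * S) ^ 3 * (2 * S) ^ 3 * (2 * S) * S ^ (-N) := by gcongr
    _ = 2 ^ 7 * (S ^ 7 * S ^ (-N)) := by ring
    _ = 2 ^ 7 * S ^ (7 - N) := by
      rw [sub_eq_add_neg, rpow_add hS0]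
      norm_cast

/-- Powers of `(j + 1) ^ (1 / 4)` with exponent below `-4` are summable. -/
lemma summable_rpow_quarter {s : ℝ} (hs : s < -4) :
    Summable (fun j : ℕ => (((j : ℝ) + 1) ^ (1 / 4 : ℝ)) ^ s) := by
  have h : Summable (fun j : ℕ => (j : ℝ) ^ (1 / 4 * s)) :=
    summable_nat_rpow.2 (by linarith)
  refine ((summable_nat_add_iff 1).2 h).congr fun j => ?_
  rw [← rpow_mul (by positivity)]
  push_cast
  rfl

/-- Convergence of the double series controlling the Patterson–Sullivan pairings,
for spectral parameters `r_j` growing like `√j` (Weyl law in dimension two). -/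
theorem summable_PS_double_series (c C : ℝ) (hc : 0 < c) (hC : 0 < C)
    (r : ℕ → ℝ)
    (hlow : ∀ j : ℕ, c * Real.sqrt (j + 1) ≤ r j)
    (hup : ∀ j : ℕ, r j ≤ C * Real.sqrt (j + 1))
    (M N : ℝ) (hM : 1 < M) (hN : 11 < N) :
    Summable (fun p : ℕ × ℕ =>
      (1 + |r p.1 - r p.2|) ^ (-M) * r p.1 ^ 3 * r p.2 ^ 3 *
        max (r p.1) (r p.2) * (1 + (r p.1 + r p.2) / 2) ^ (-N)) := by
  have hr : ∀ j, 0 < r j := fun j => lt_of_lt_of_le (by positivity) (hlow j)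
  have hsum := summable_rpow_quarter (s := 7 - N) (by linarith)
  have hprod := (hsum.mul_of_nonneg hsum (fun j => by positivity)
    (fun j => by positivity)).mul_left (2 ^ 7 * c ^ (7 - N))
  refine hprod.of_nonneg_of_le (fun p => ?_) (fun p => ?_)
  · have := hr p.1
    have := hr p.2
    have : 0 < max (r p.1) (r p.2) := lt_max_of_lt_left (hr p.1)
    positivity
  · refine (PS_term_le (hr p.1) (hr p.2) (by linarith)).trans ?_
    have hsq : ∀ j : ℕ, c * (((j : ℝ) + 1) ^ (1 / 4 : ℝ)) ^ 2 ≤ r j := fun j => by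
      refine le_of_eq_of_le ?_ (hlow j)
      rw [sqrt_eq_rpow, ← rpow_natCast, ← rpow_mul (by positivity)]
      norm_num
    have h1 := hsq p.1
    have h2 := hsq p.2
    have ha : 0 < ((p.1 : ℝ) + 1) ^ (1 / 4 : ℝ) := by positivity
    have hb : 0 < ((p.2 : ℝ) + 1) ^ (1 / 4 : ℝ) := by positivity
    generalize ((p.1 : ℝ) + 1) ^ (1 / 4 : ℝ) = a at *
    generalize ((p.2 : ℝ) + 1) ^ (1 / 4 : ℝ) = b at *
    have hab : c * (a * b) ≤ 1 + (r p.1 + r p.2) / 2 := by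
      nlinarith [mul_nonneg hc.le (sq_nonneg (a - b))]
    have h := rpow_le_rpow_of_nonpos (by positivity) hab (by linarith : 7 - N ≤ 0)
    rw [mul_rpow hc.le (by positivity), mul_rpow ha.le hb.le] at h
    rw [mul_assoc]
    gcongr
end
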